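/- There is a unique continuous function Φ : ℝ^d × ℝ^d → ℝ such that Φ(λ, Y) = (π(λ)π(Y))^{−1} ∑_{w∈W} det(w) e^{⟨λ, wY⟩} whenever π(λ)π(Y) ≠ 0. Let λ₀ and Y₀ lie in the closed positive Weyl chamber {X ∈ ℝ^d : ⟨α,X⟩ ≥ 0 for all α ∈ Σ⁺}, both singular, and assume the Killing-max property: {w ∈ W : ⟨λ₀, wY₀⟩ = ⟨λ₀, Y₀⟩} = {w₁w₂ : w₁ ∈ W_{λ₀}, w₂ ∈ W_{Y₀}}. Let M = Σ⁺ ∖ (Σ⁺_{λ₀} ∪ Σ⁺_{Y₀}), m = |M|, π_M(X) = ∏_{α∈M} ⟨α,X⟩. Then lim_{t→∞} t^m e^{−t⟨λ₀,Y₀⟩} Φ(λ₀, tY₀) = (c_{λ₀,Y₀}/(c_{λ₀} c_{Y₀})) · (|W_{λ₀}| |W_{Y₀}| / |W_{λ₀} ∩ W_{Y₀}|) · (π_M(λ₀) π_M(Y₀))^{−1}. -/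

import Mathlib

open scoped BigOperators RealInnerProductSpace Classical
open Finset

noncomputable section

/-- Euclidean space `ℝ^d`. -/
abbrev E (d : ℕ) := EuclideanSpace ℝ (Fin d)

/-- The reflection `s_α x = x - 2 (⟪α, x⟫/⟪α, α⟫) α` fixing the hyperplane `α^⊥`. -/
def reflVec {d : ℕ} (α x : E d) : E d := x - (2 * ⟪α, x⟫ / ⟪α, α⟫) • α

/-- `Sig` is a reduced root system in `ℝ^d`: a finite set of nonzero vectors spanning `ℝ^d`,
with `Sig ∩ ℝα = {α, -α}` and `s_α (Sig) = Sig` for all `α ∈ Sig`. -/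
def IsRootSystem {d : ℕ} (Sig : Finset (E d)) : Prop :=
  (0 : E d) ∉ Sig ∧
  Submodule.span ℝ (Sig : Set (E d)) = ⊤ ∧
  (∀ α ∈ Sig, ∀ t : ℝ, t • α ∈ Sig → t = 1 ∨ t = -1) ∧
  (∀ α ∈ Sig, ∀ β ∈ Sig, reflVec α β ∈ Sig)

/-- `Sp` is a positive system for `Sig`: `Sp = {α ∈ Sig : ⟪α, v⟫ > 0}` for a vector `v` not
orthogonal to any root. -/
def IsPositiveSystem {d : ℕ} (Sig Sp : Finset (E d)) : Prop :=
  ∃ v : E d, (∀ α ∈ Sig, ⟪α, v⟫ ≠ 0) ∧ ∀ α : E d, α ∈ Sp ↔ α ∈ Sig ∧ 0 < ⟪α, v⟫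

/-- The Weyl group of `Sig`: the subgroup of the orthogonal group of `ℝ^d` generated by the
reflections `s_α`, `α ∈ Sig`. -/
def weylGroup {d : ℕ} (Sig : Finset (E d)) : Subgroup (E d ≃ₗᵢ[ℝ] E d) :=
  Subgroup.closure {w : E d ≃ₗᵢ[ℝ] E d | ∃ α ∈ Sig, ∀ x : E d, w x = reflVec α x}

/-- Determinant of an orthogonal transformation (`±1`). -/
def dsign {d : ℕ} (w : E d ≃ₗᵢ[ℝ] E d) : ℝ := LinearMap.det (w.toLinearEquiv.toLinearMap)

/-- `π(X) = ∏_{α ∈ Sp} ⟪α, X⟫`. -/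
def piP {d : ℕ} (Sp : Finset (E d)) (X : E d) : ℝ := ∏ α ∈ Sp, ⟪α, X⟫

/-- Composition of directional-derivative operators along the vectors of a list. -/
def Dop {d : ℕ} : List (E d) → (E d → ℝ) → E d → ℝ
  | [], f => f
  | v :: L, f => fun x => fderiv ℝ (Dop L f) x v

/-- The constant `c_S = ∂(π_S)(π_S)` attached to a finite set `S` of vectors (the derivative
is a constant function; we evaluate it at `0`). -/
def cConst {d : ℕ} (S : Finset (E d)) : ℝ := Dop S.toList (piP S) 0

open scoped ContDiff Topology

section SmoothDivision

/-- Integrals over `[0, 1]` depend as smoothly on parameters as their integrands do. -/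
theorem contDiff_parametric_integral {H : Type} [NormedAddCommGroup H] [NormedSpace ℝ H]
    [FiniteDimensional ℝ H] (n : ℕ) :
    ∀ {F : Type} [NormedAddCommGroup F] [NormedSpace ℝ F] (f : H × ℝ → F),
      ContDiff ℝ n f → ContDiff ℝ n (fun x => ∫ s in (0 : ℝ)..1, f (x, s)) := by
  induction n with
  | zero =>
    intro F _ _ f hf
    have hc : Continuous f := hf.continuous
    simpa using
      (intervalIntegral.continuous_parametric_intervalIntegral_of_continuous'
        (f := fun x s => f (x, s)) hc 0 1)
  | succ n ih =>
    intro F _ _ f hf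
    rw [Nat.cast_add, Nat.cast_one] at hf ⊢
    have hf' : ContDiff ℝ n (fun z : H × ℝ =>
        (fderiv ℝ f z).comp (ContinuousLinearMap.inl ℝ H ℝ)) :=
      (hf.fderiv_right le_rfl).clm_comp contDiff_const
    refine contDiff_succ_iff_hasFDerivAt.2 ⟨_, ih _ hf', fun x => ?_⟩
    have hc : Continuous f := hf.continuous
    have hc' := hf'.continuous
    obtain ⟨C, hC⟩ := ((isCompact_closedBall x 1).prod
      (isCompact_Icc (a := (0 : ℝ)) (b := 1))).exists_bound_of_continuousOn hc'.continuousOn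
    have hd : Differentiable ℝ f := hf.differentiable (by simp)
    refine intervalIntegral.hasFDerivAt_integral_of_dominated_of_fderiv_le
      (F' := fun x s => (fderiv ℝ f (x, s)).comp (ContinuousLinearMap.inl ℝ H ℝ))
      (bound := fun _ => C)
      (Metric.ball_mem_nhds x one_pos) ?_ ?_ ?_ ?_ (by simp) ?_
    · exact Filter.Eventually.of_forall fun y =>
        (hc.comp (by fun_prop : Continuous fun s : ℝ => (y, s))).aestronglyMeasurable
    · exact (hc.comp (by fun_prop : Continuous fun s : ℝ => (x, s))).intervalIntegrable _ _
    · exact (hc'.comp (by fun_prop : Continuous fun s : ℝ => (x, s))).aestronglyMeasurable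
    · refine Filter.Eventually.of_forall fun t ht y hy => hC (y, t) ⟨?_, ?_⟩
      · exact Metric.ball_subset_closedBall hy
      · rw [Set.uIoc_of_le zero_le_one] at ht
        exact Set.Ioc_subset_Icc_self ht
    · exact Filter.Eventually.of_forall fun t _ y _ =>
        (hd (y, t)).hasFDerivAt.comp y (hasFDerivAt_prodMk_left y t)

variable {V : Type} [NormedAddCommGroup V] [NormedSpace ℝ V]

/-- Hadamard's lemma: a smooth function vanishing on a hyperplane is divisible by the
corresponding linear form. -/
theorem exists_contDiff_eq_mul [FiniteDimensional ℝ V] {f : V → ℝ} (hf : ContDiff ℝ ∞ f)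
    {l : V →L[ℝ] ℝ} (hl : ∃ y, l y ≠ 0) (h0 : ∀ x, l x = 0 → f x = 0) :
    ∃ g : V → ℝ, ContDiff ℝ ∞ g ∧ ∀ x, f x = l x * g x := by
  obtain ⟨b, hb⟩ := hl
  obtain ⟨a, ha⟩ : ∃ a, l a = 1 := ⟨(l b)⁻¹ • b, by simp [hb]⟩
  have hp : ContDiff ℝ ∞ (fun z : V × ℝ =>
      fderiv ℝ f (z.1 - l z.1 • a + z.2 • (l z.1 • a)) a) := by
    have h1 : ContDiff ℝ ∞ (fderiv ℝ f) := hf.fderiv_right (by simp)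
    exact (h1.comp (by fun_prop)).clm_apply contDiff_const
  refine ⟨fun x => ∫ s in (0 : ℝ)..1, fderiv ℝ f (x - l x • a + s • (l x • a)) a, ?_, ?_⟩
  · rw [contDiff_infty]
    intro n
    exact contDiff_parametric_integral n _ (hp.of_le (by exact_mod_cast le_top))
  · intro x
    have hd : Differentiable ℝ f := hf.differentiable (by simp)
    have hder : ∀ s ∈ Set.uIcc (0 : ℝ) 1,
        HasDerivAt (fun s : ℝ => f (x - l x • a + s • (l x • a)))
          (l x * fderiv ℝ f (x - l x • a + s • (l x • a)) a) s := by
      intro s _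
      have h1 : HasDerivAt (fun s : ℝ => x - l x • a + s • (l x • a)) (l x • a) s := by
        simpa using ((hasDerivAt_id s).smul_const (l x • a)).const_add (x - l x • a)
      have h2 := (hd _).hasFDerivAt.comp_hasDerivAt s h1
      rw [map_smul, smul_eq_mul] at h2
      exact h2
    have hcont : Continuous fun s : ℝ =>
        l x * fderiv ℝ f (x - l x • a + s • (l x • a)) a :=
      continuous_const.mul (hp.continuous.comp (by fun_prop : Continuous fun s : ℝ => (x, s)))
    have := intervalIntegral.integral_eq_sub_of_hasDerivAt hder (hcont.intervalIntegrable _ _)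
    rw [intervalIntegral.integral_const_mul] at this
    rw [this, h0 (x - l x • a + (0 : ℝ) • (l x • a)) (by simp [ha])]
    simp

theorem eq_zero_of_mul_eq_zero_on {h : V → ℝ} (hh : Continuous h) (l : V →L[ℝ] ℝ)
    (U : Submodule ℝ V) (hl : ∃ y ∈ U, l y ≠ 0) (h0 : ∀ x ∈ U, l x * h x = 0) :
    ∀ x ∈ U, h x = 0 := by
  intro x hx
  by_cases hlx : l x = 0
  · obtain ⟨y, hyU, hy⟩ := hl
    have hc : Continuous fun s : ℝ => h (x + s • y) := by fun_prop
    have h1 : Filter.Tendsto (fun s : ℝ => h (x + s • y)) (𝓝[≠] 0) (𝓝 (h x)) := by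
      simpa using (hc.tendsto 0).mono_left nhdsWithin_le_nhds
    refine tendsto_nhds_unique h1 (tendsto_const_nhds.congr' ?_)
    filter_upwards [self_mem_nhdsWithin] with s hs
    have := h0 (x + s • y) (U.add_mem hx (U.smul_mem s hyU))
    have hne : l (x + s • y) ≠ 0 := by simpa [hlx, hy] using hs
    exact ((mul_eq_zero.1 this).resolve_left hne).symm
  · exact (mul_eq_zero.1 (h0 x hx)).resolve_left hlx

theorem eq_zero_of_prod_mul_eq_zero_on {ι : Type} (l : ι → V →L[ℝ] ℝ) (U : Submodule ℝ V)
    (T : Finset ι) : ∀ {h : V → ℝ}, Continuous h → (∀ i ∈ T, ∃ y ∈ U, l i y ≠ 0) →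
      (∀ x ∈ U, (∏ i ∈ T, l i x) * h x = 0) → ∀ x ∈ U, h x = 0 := by
  induction T using Finset.induction_on with
  | empty => intro h _ _ h0; simpa using h0
  | insert i T hi ih =>
    intro h hh hl h0
    refine eq_zero_of_mul_eq_zero_on hh (l i) U (hl i (by simp)) ?_
    refine ih (h := fun x => l i x * h x) (by fun_prop) (fun j hj => hl j (by simp [hj])) ?_
    intro x hx
    have := h0 x hx
    rw [Finset.prod_insert hi] at this
    linear_combination this

/-- A smooth function vanishing on finitely many distinct hyperplanes is divisible by the product
of the corresponding linear forms. -/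
theorem exists_contDiff_eq_prod_mul [FiniteDimensional ℝ V] {ι : Type} (l : ι → V →L[ℝ] ℝ)
    {f : V → ℝ} (hf : ContDiff ℝ ∞ f) (T : Finset ι) :
    (∀ i ∈ T, ∃ y, l i y ≠ 0) →
    (∀ i ∈ T, ∀ j ∈ T, i ≠ j → ∃ y, l i y = 0 ∧ l j y ≠ 0) →
    (∀ i ∈ T, ∀ x, l i x = 0 → f x = 0) →
    ∃ g : V → ℝ, ContDiff ℝ ∞ g ∧ ∀ x, f x = (∏ i ∈ T, l i x) * g x := by
  induction T using Finset.induction_on with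
  | empty => intro _ _ _; exact ⟨f, hf, by simp⟩
  | insert i T hi ih =>
    intro hne hpair h0
    obtain ⟨g, hg, hfg⟩ := ih (fun j hj => hne j (by simp [hj]))
      (fun j hj k hk => hpair j (by simp [hj]) k (by simp [hk])) (fun j hj => h0 j (by simp [hj]))
    have hg0 : ∀ x ∈ (l i).ker, g x = 0 := by
      refine eq_zero_of_prod_mul_eq_zero_on l _ T hg.continuous ?_ ?_
      · intro j hj
        obtain ⟨y, hy, hy'⟩ := hpair i (by simp) j (by simp [hj]) (by rintro rfl; exact hi hj)
        exact ⟨y, hy, hy'⟩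
      · intro x hx
        rw [← hfg]
        exact h0 i (by simp) x hx
    obtain ⟨g', hg', hgg⟩ := exists_contDiff_eq_mul hg (hne i (by simp)) (fun x hx => hg0 x hx)
    refine ⟨g', hg', fun x => ?_⟩
    rw [hfg, hgg, Finset.prod_insert hi]
    ring

end SmoothDivision

section IteratedDerivatives

variable {d : ℕ}

theorem Dop_append (L₁ L₂ : List (E d)) (f : E d → ℝ) :
    Dop (L₁ ++ L₂) f = Dop L₁ (Dop L₂ f) := by
  induction L₁ with
  | nil => rfl
  | cons v L ih => simp only [List.cons_append, Dop, ih]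

theorem ContDiff.fderiv_apply_const {f : E d → ℝ} (hf : ContDiff ℝ ∞ f) (v : E d) :
    ContDiff ℝ ∞ (fun x => fderiv ℝ f x v) :=
  (hf.fderiv_right (by simp)).clm_apply contDiff_const

theorem contDiff_Dop {f : E d → ℝ} (hf : ContDiff ℝ ∞ f) (L : List (E d)) :
    ContDiff ℝ ∞ (Dop L f) := by
  induction L with
  | nil => exact hf
  | cons v L ih => exact ih.fderiv_apply_const v

theorem differentiable_Dop {f : E d → ℝ} (hf : ContDiff ℝ ∞ f) (L : List (E d)) :
    Differentiable ℝ (Dop L f) :=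
  (contDiff_Dop hf L).differentiable (by simp)

theorem Dop_const_mul {f : E d → ℝ} (hf : ContDiff ℝ ∞ f) (c : ℝ) (L : List (E d)) :
    Dop L (fun x => c * f x) = fun x => c * Dop L f x := by
  induction L with
  | nil => rfl
  | cons v L ih =>
    funext x
    simp only [Dop, ih]
    rw [fderiv_const_mul (differentiable_Dop hf L x)]
    simp

theorem Dop_add {f g : E d → ℝ} (hf : ContDiff ℝ ∞ f) (hg : ContDiff ℝ ∞ g) (L : List (E d)) :
    Dop L (fun x => f x + g x) = fun x => Dop L f x + Dop L g x := by
  induction L with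
  | nil => rfl
  | cons v L ih =>
    funext x
    simp only [Dop, ih]
    rw [fderiv_fun_add (differentiable_Dop hf L x) (differentiable_Dop hg L x)]
    simp

theorem Dop_sum {ι : Type*} (s : Finset ι) {f : ι → E d → ℝ} (hf : ∀ i, ContDiff ℝ ∞ (f i))
    (L : List (E d)) :
    Dop L (fun x => ∑ i ∈ s, f i x) = fun x => ∑ i ∈ s, Dop L (f i) x := by
  induction L with
  | nil => rfl
  | cons v L ih =>
    funext x
    simp only [Dop, ih]
    rw [fderiv_fun_sum (fun i _ => differentiable_Dop (hf i) L x)]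
    simp

theorem Dop_perm {f : E d → ℝ} (hf : ContDiff ℝ ∞ f) {L₁ L₂ : List (E d)} (h : L₁.Perm L₂) :
    Dop L₁ f = Dop L₂ f := by
  induction h with
  | nil => rfl
  | cons v _ ih => simp only [Dop, ih]
  | swap v w L =>
    funext x
    have hg := contDiff_Dop hf L
    have hd : Differentiable ℝ (fderiv ℝ (Dop L f)) :=
      (hg.fderiv_right (m := ∞) (by simp)).differentiable (by simp)
    have key : ∀ a b : E d, fderiv ℝ (fun y => fderiv ℝ (Dop L f) y a) x b =
        fderiv ℝ (fderiv ℝ (Dop L f)) x b a := by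
      intro a b
      rw [fderiv_clm_apply (hd x) (differentiableAt_const a)]
      simp
    simp only [Dop, key]
    exact (hg.contDiffAt.isSymmSndFDerivAt
      (by
        rw [minSmoothness_of_isRCLikeNormedField]
        exact WithTop.coe_le_coe.2 (le_top : (2 : ℕ∞) ≤ ⊤))).eq _ _
  | trans _ _ ih₁ ih₂ => exact ih₁.trans ih₂

theorem Dop_comp_clm {f : E d → ℝ} (hf : ContDiff ℝ ∞ f) (A : E d →L[ℝ] E d)
    (L : List (E d)) :
    Dop L (fun x => f (A x)) = fun x => Dop (L.map A) f (A x) := by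
  induction L with
  | nil => rfl
  | cons v L ih =>
    funext x
    simp only [Dop, ih, List.map_cons]
    have := ((differentiable_Dop hf (L.map A) (A x)).hasFDerivAt.comp x A.hasFDerivAt).fderiv
    simp only [Function.comp_def] at this
    rw [this]
    rfl

theorem Dop_comp_add (f : E d → ℝ) (a : E d) (L : List (E d)) :
    Dop L (fun x => f (x + a)) = fun x => Dop L f (x + a) := by
  induction L with
  | nil => rfl
  | cons v L ih =>
    funext x
    simp only [Dop, ih]
    rw [fderiv_comp_add_right]

theorem Dop_map_smul {f : E d → ℝ} (hf : ContDiff ℝ ∞ f) {ι : Type*} (e : ι → ℝ) (s : ι → E d)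
    (L : List ι) :
    Dop (L.map (fun v => e v • s v)) f = fun x => (L.map e).prod * Dop (L.map s) f x := by
  induction L with
  | nil => simp [Dop]
  | cons v L ih =>
    funext x
    simp only [Dop, ih, List.map_cons, List.prod_cons]
    rw [fderiv_const_mul (differentiable_Dop hf _ x)]
    simp only [map_smul, _root_.smul_apply, smul_eq_mul]
    ring

theorem Dop_mul_of_fderiv_eq_zero {f g : E d → ℝ} (hf : ContDiff ℝ ∞ f) (hg : ContDiff ℝ ∞ g)
    (L : List (E d)) (h : ∀ v ∈ L, ∀ x, fderiv ℝ g x v = 0) :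
    Dop L (fun x => f x * g x) = fun x => Dop L f x * g x := by
  induction L with
  | nil => rfl
  | cons v L ih =>
    funext x
    simp only [Dop, ih (fun w hw => h w (by simp [hw]))]
    rw [fderiv_fun_mul (differentiable_Dop hf L x) (hg.differentiable (by simp) x)]
    simp [h v (by simp) x, mul_comm]

theorem hasFDerivAt_exp_inner (u x : E d) :
    HasFDerivAt (fun x : E d => Real.exp ⟪u, x⟫) (Real.exp ⟪u, x⟫ • innerSL ℝ u) x :=
  ((innerSL ℝ u).hasFDerivAt (x := x)).exp

theorem fderiv_exp_inner (u x v : E d) :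
    fderiv ℝ (fun x : E d => Real.exp ⟪u, x⟫) x v = ⟪u, v⟫ * Real.exp ⟪u, x⟫ := by
  rw [(hasFDerivAt_exp_inner u x).fderiv]
  simp [mul_comm]

theorem Dop_exp_inner (u : E d) (L : List (E d)) :
    Dop L (fun x => Real.exp ⟪u, x⟫) =
      fun x => (L.map (fun v => ⟪v, u⟫)).prod * Real.exp ⟪u, x⟫ := by
  induction L with
  | nil => simp [Dop]
  | cons v L ih =>
    funext x
    simp only [Dop, ih, List.map_cons, List.prod_cons]
    rw [fderiv_const_mul (hasFDerivAt_exp_inner u x).differentiableAt]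
    simp only [_root_.smul_apply, smul_eq_mul, fderiv_exp_inner,
      real_inner_comm v u]
    ring

theorem contDiff_inner_const (u : E d) : ContDiff ℝ ∞ (fun x : E d => ⟪u, x⟫) :=
  (innerSL ℝ u).contDiff

theorem contDiff_piP (S : Finset (E d)) : ContDiff ℝ ∞ (piP S) := by
  exact contDiff_prod fun α _ => contDiff_inner_const α

theorem piP_smul (S : Finset (E d)) (c : ℝ) (x : E d) : piP S (c • x) = c ^ S.card * piP S x := by
  simp [piP, inner_smul_right, Finset.prod_mul_distrib]

/-- `f` vanishes to order at least `k` at `x₀`. -/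
def VanishesToOrder (k : ℕ) (f : E d → ℝ) (x₀ : E d) : Prop :=
  ∀ K : List (E d), K.length < k → Dop K f x₀ = 0

theorem VanishesToOrder.inner_mul {x₀ α : E d} (hα : ⟪α, x₀⟫ = 0) (k : ℕ) :
    ∀ {f : E d → ℝ}, ContDiff ℝ ∞ f → VanishesToOrder k f x₀ →
      VanishesToOrder (k + 1) (fun x => ⟪α, x⟫ * f x) x₀ := by
  induction k with
  | zero =>
    intro f _ _ K hK
    obtain rfl : K = [] := by simpa using hK
    simp [Dop, hα]
  | succ k ih =>
    intro f hf h K hK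
    rcases List.eq_nil_or_concat K with rfl | ⟨K', v, rfl⟩
    · simp [Dop, hα]
    · rw [List.concat_eq_append] at hK ⊢
      have hlen : K'.length < k + 1 := by simpa using hK
      have hv : VanishesToOrder k (fun x => fderiv ℝ f x v) x₀ := by
        intro K'' hK''
        have := h (K'' ++ [v]) (by simpa using hK'')
        rwa [Dop_append] at this
      have hD : Dop [v] (fun x => ⟪α, x⟫ * f x) =
          fun x => ⟪α, v⟫ * f x + ⟪α, x⟫ * fderiv ℝ f x v := by
        funext x
        have h1 := ((innerSL ℝ α).hasFDerivAt (x := x)).mul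
          (hf.differentiable (by simp) x).hasFDerivAt
        simp only [innerSL_apply_apply] at h1
        simp only [Dop]
        erw [h1.fderiv]
        simp
        ring
      rw [Dop_append, hD, Dop_add (by fun_prop)
        ((contDiff_inner_const α).mul (hf.fderiv_apply_const v)),
        Dop_const_mul hf]
      simp only [h K' hlen, ih (hf.fderiv_apply_const v) hv K' hlen]
      simp

theorem VanishesToOrder.piP_mul {x₀ : E d} {H : E d → ℝ} (hH : ContDiff ℝ ∞ H)
    (h : VanishesToOrder 1 H x₀) (S : Finset (E d)) :
    (∀ α ∈ S, ⟪α, x₀⟫ = 0) → VanishesToOrder (S.card + 1) (fun x => piP S x * H x) x₀ := by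
  induction S using Finset.induction_on with
  | empty => intro _; simpa [piP] using h
  | insert α S hα ih =>
    intro hS
    have h1 := VanishesToOrder.inner_mul (hS α (by simp)) _
      ((contDiff_piP S).mul hH) (ih (fun β hβ => hS β (by simp [hβ])))
    rw [Finset.card_insert_of_notMem hα]
    convert h1 using 2 with x
    simp [piP, Finset.prod_insert hα, mul_assoc]

/-- If the linear forms in `S` vanish at `x₀`, then `∂(π_S)(π_S G)(x₀) = c_S G(x₀)`. -/
theorem Dop_piP_mul {S : Finset (E d)} {x₀ : E d} (hS : ∀ α ∈ S, ⟪α, x₀⟫ = 0) {G : E d → ℝ}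
    (hG : ContDiff ℝ ∞ G) :
    Dop S.toList (fun x => piP S x * G x) x₀ = cConst S * G x₀ := by
  have hH : ContDiff ℝ ∞ (fun x => G x - G x₀) := by fun_prop
  have hv : VanishesToOrder 1 (fun x => G x - G x₀) x₀ := by
    intro K hK
    obtain rfl : K = [] := by simpa using hK
    simp [Dop]
  have h1 := VanishesToOrder.piP_mul hH hv S hS S.toList (by simp)
  have hp := contDiff_piP S
  have hsplit : (fun x => piP S x * G x) =
      fun x => piP S x * (G x - G x₀) + G x₀ * piP S x := by
    funext x; ring
  have htrans : Dop S.toList (piP S) x₀ = cConst S := by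
    have h2 := congrFun (Dop_comp_add (piP S) x₀ S.toList) 0
    have h3 : (fun x => piP S (x + x₀)) = piP S := by
      funext x
      refine Finset.prod_congr rfl fun α hα => ?_
      rw [inner_add_right, hS α hα, add_zero]
    rw [h3, zero_add] at h2
    exact h2.symm
  rw [hsplit, Dop_add (hp.mul hH) (by fun_prop), Dop_const_mul hp]
  simp only [h1, htrans]
  ring

/-- The derivatives of `p` of order `n` along the ray through `X` grow like `t ^ j` for `n = 0`,
with leading coefficient `a`, and more slowly for `n > 0`. -/
def GrowsAlong (X : E d) (j : ℕ) (p : E d → ℝ) (a : ℝ) : Prop :=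
  ∀ K : List (E d), Filter.Tendsto (fun t : ℝ => Dop K p (t • X) / t ^ j) Filter.atTop
    (𝓝 (if K = [] then a else 0))

theorem GrowsAlong.of_homogeneous {q : E d → ℝ} (hq : ContDiff ℝ ∞ q) {j : ℕ} (L : List (E d))
    (hom : ∀ c x, q (c • x) = c ^ (j + L.length) * q x) (X : E d) :
    GrowsAlong X j (Dop L q) (Dop L q X) := by
  intro K
  have key : ∀ t : ℝ, 0 < t →
      Dop K (Dop L q) (t • X) / t ^ j = Dop K (Dop L q) X * (t⁻¹) ^ K.length := by
    intro t ht
    have h1 := congrFun (Dop_comp_clm hq (t • ContinuousLinearMap.id ℝ (E d)) (K ++ L)) X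
    have h2 : (fun x => q ((t • ContinuousLinearMap.id ℝ (E d)) x)) =
        fun x => t ^ (j + L.length) * q x := by
      funext x; simp [hom]
    have h3 : (K ++ L).map (t • ContinuousLinearMap.id ℝ (E d)) =
        (K ++ L).map (fun v => t • id v) := rfl
    rw [h2, h3, Dop_const_mul hq, Dop_map_smul hq (fun _ => t) id] at h1
    simp only [List.map_const', List.prod_replicate, List.map_id, List.length_append,
      Dop_append, _root_.smul_apply, ContinuousLinearMap.id_apply] at h1
    have htj : t ^ j ≠ 0 := by positivity
    have htl : t ^ L.length ≠ 0 := by positivity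
    rw [inv_pow, div_eq_iff htj]
    field_simp
    apply mul_left_cancel₀ htl
    linear_combination -h1
  refine Filter.Tendsto.congr' (f₁ := fun t : ℝ => Dop K (Dop L q) X * (t⁻¹) ^ K.length) ?_ ?_
  · filter_upwards [Filter.eventually_gt_atTop 0] with t ht using (key t ht).symm
  · have h := ((tendsto_inv_atTop_zero (𝕜 := ℝ)).pow K.length).const_mul (Dop K (Dop L q) X)
    rcases K with _ | ⟨v, K⟩
    · simp [Dop]
    · simpa using h

theorem GrowsAlong.Dop_mul_exp {X u : E d} {j : ℕ} (L : List (E d)) :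
    ∀ {p : E d → ℝ} {a : ℝ}, ContDiff ℝ ∞ p → GrowsAlong X j p a →
    Filter.Tendsto (fun t : ℝ => Dop L (fun x => p x * Real.exp ⟪u, x⟫) (t • X) / t ^ j *
      Real.exp (-(t * ⟪u, X⟫))) Filter.atTop (𝓝 ((L.map (fun v => ⟪v, u⟫)).prod * a)) := by
  induction L using List.reverseRecOn with
  | nil =>
    intro p a _ h
    have := h []
    simp only [if_true] at this
    simp only [Dop, List.map_nil, List.prod_nil, one_mul, inner_smul_right]
    convert this using 2 with t
    rw [Real.exp_neg, Dop]
    field_simp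
  | append_singleton L v ih =>
    intro p a hp h
    have hd : Dop [v] (fun x => p x * Real.exp ⟪u, x⟫) =
        fun x => (fderiv ℝ p x v + ⟪v, u⟫ * p x) * Real.exp ⟪u, x⟫ := by
      funext x
      simp only [Dop]
      rw [fderiv_fun_mul (hp.differentiable (by simp) x)
        (hasFDerivAt_exp_inner u x).differentiableAt]
      simp only [_root_.add_apply, _root_.smul_apply, smul_eq_mul,
        fderiv_exp_inner, real_inner_comm v u]
      ring
    have hg : GrowsAlong X j (fun x => fderiv ℝ p x v + ⟪v, u⟫ * p x) (⟪v, u⟫ * a) := by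
      intro K
      rw [Dop_add (hp.fderiv_apply_const v) (by fun_prop), Dop_const_mul hp]
      have h1 := h (K ++ [v])
      rw [Dop_append] at h1
      have h2 := h1.add ((h K).const_mul ⟪v, u⟫)
      convert h2 using 2 with t
      · simp only [Dop]
        ring
      · simp
    have := ih (p := fun x => fderiv ℝ p x v + ⟪v, u⟫ * p x)
      (by have := hp.fderiv_apply_const v; fun_prop) hg
    rw [Dop_append, hd]
    simpa [mul_assoc] using this

end IteratedDerivatives

section WeylGroup

variable {d : ℕ}

/-- The reflection `s_α` as an isometry. -/
def rootRefl (α : E d) : E d ≃ₗᵢ[ℝ] E d := (Submodule.span ℝ {α})ᗮ.reflection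

theorem rootRefl_apply (α x : E d) : rootRefl α x = reflVec α x := by
  rw [rootRefl, Submodule.reflection_orthogonal_apply, Submodule.reflection_singleton_apply,
    reflVec, real_inner_self_eq_norm_sq, mul_div_assoc, ← smul_smul, neg_sub]
  simp [two_smul]

theorem rootRefl_mul_self (α : E d) : rootRefl α * rootRefl α = 1 :=
  Submodule.reflection_mul_reflection _

theorem rootRefl_inv (α : E d) : (rootRefl α)⁻¹ = rootRefl α := Submodule.reflection_inv

theorem rootRefl_rootRefl (α x : E d) : rootRefl α (rootRefl α x) = x :=
  Submodule.reflection_reflection _ x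

theorem rootRefl_neg (α : E d) : rootRefl (-α) = rootRefl α := by
  ext1 x
  rw [rootRefl_apply, rootRefl_apply, reflVec, reflVec, inner_neg_left, inner_neg_neg, smul_neg,
    ← neg_smul]
  congr 2
  ring

theorem rootRefl_self (α : E d) : rootRefl α α = -α :=
  Submodule.reflection_orthogonalComplement_singleton_eq_neg α

theorem inner_rootRefl_left (α x y : E d) : ⟪rootRefl α x, y⟫ = ⟪x, rootRefl α y⟫ := by
  conv_lhs => rw [← rootRefl_rootRefl α y, LinearIsometryEquiv.inner_map_map]

theorem inner_inv_apply (w : E d ≃ₗᵢ[ℝ] E d) (x y : E d) : ⟪w⁻¹ x, y⟫ = ⟪x, w y⟫ := by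
  rw [← LinearIsometryEquiv.inner_map_map w (w⁻¹ x) y]
  congr 1
  exact w.apply_symm_apply x

theorem isometry_mul_apply (w₁ w₂ : E d ≃ₗᵢ[ℝ] E d) (x : E d) : (w₁ * w₂) x = w₁ (w₂ x) := rfl

theorem conj_rootRefl (w : E d ≃ₗᵢ[ℝ] E d) (α : E d) :
    w * rootRefl α * w⁻¹ = rootRefl (w α) := by
  ext1 x
  have hx : w (w⁻¹ x) = x := w.apply_symm_apply x
  rw [isometry_mul_apply, isometry_mul_apply, rootRefl_apply,
    rootRefl_apply, reflVec, reflVec, map_sub, map_smul, hx, LinearIsometryEquiv.inner_map_map,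
    real_inner_comm, inner_inv_apply, real_inner_comm]

theorem dsign_mul (w₁ w₂ : E d ≃ₗᵢ[ℝ] E d) : dsign (w₁ * w₂) = dsign w₁ * dsign w₂ := by
  unfold dsign
  rw [← LinearMap.det_comp]
  rfl

theorem dsign_one : dsign (1 : E d ≃ₗᵢ[ℝ] E d) = 1 := LinearMap.det_id

theorem dsign_rootRefl {α : E d} (hα : α ≠ 0) : dsign (rootRefl α) = -1 := by
  have h := Submodule.det_reflection (𝕜 := ℝ) (Submodule.span ℝ {α})ᗮ
  rw [Submodule.orthogonal_orthogonal, finrank_span_singleton hα, pow_one] at h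
  exact h

theorem rootRefl_mem_weylGroup {Sig : Finset (E d)} {α : E d} (hα : α ∈ Sig) :
    rootRefl α ∈ weylGroup Sig :=
  Subgroup.subset_closure ⟨α, hα, rootRefl_apply α⟩

/-- The axioms of a reduced root system other than the spanning condition. -/
structure IsReducedSystem (Sig : Finset (E d)) : Prop where
  zero_notMem : (0 : E d) ∉ Sig
  eq_one_or : ∀ α ∈ Sig, ∀ t : ℝ, t • α ∈ Sig → t = 1 ∨ t = -1
  refl_mem : ∀ α ∈ Sig, ∀ β ∈ Sig, reflVec α β ∈ Sig

theorem IsRootSystem.isReducedSystem {Sig : Finset (E d)} (h : IsRootSystem Sig) :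
    IsReducedSystem Sig :=
  ⟨h.1, h.2.2.1, h.2.2.2⟩

variable {Sig Sp : Finset (E d)}

theorem weylGroup_induction {p : (E d ≃ₗᵢ[ℝ] E d) → Prop} (one : p 1)
    (mul : ∀ α ∈ Sig, ∀ w, p w → p (rootRefl α * w)) {w : E d ≃ₗᵢ[ℝ] E d}
    (hw : w ∈ weylGroup Sig) : p w := by
  have hgen : ∀ x : E d ≃ₗᵢ[ℝ] E d, (∃ α ∈ Sig, ∀ y, x y = reflVec α y) →
      ∃ α ∈ Sig, x = rootRefl α := by
    rintro x ⟨α, hα, h⟩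
    exact ⟨α, hα, LinearIsometryEquiv.ext fun y => by rw [h, rootRefl_apply]⟩
  induction hw using Subgroup.closure_induction_left with
  | one => exact one
  | mul_left x hx y _ ih =>
    obtain ⟨α, hα, rfl⟩ := hgen x hx
    exact mul α hα y ih
  | inv_mul_cancel x hx y _ ih =>
    obtain ⟨α, hα, rfl⟩ := hgen x hx
    rw [rootRefl_inv]
    exact mul α hα y ih

theorem IsReducedSystem.neg_mem (hR : IsReducedSystem Sig) {α : E d} (hα : α ∈ Sig) : -α ∈ Sig := by
  have := hR.refl_mem α hα α hα
  rwa [← rootRefl_apply, rootRefl_self] at this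

theorem IsReducedSystem.ne_zero (hR : IsReducedSystem Sig) {α : E d} (hα : α ∈ Sig) : α ≠ 0 := by
  rintro rfl
  exact hR.zero_notMem hα

theorem IsReducedSystem.apply_mem (hR : IsReducedSystem Sig) {w : E d ≃ₗᵢ[ℝ] E d}
    (hw : w ∈ weylGroup Sig) {β : E d} (hβ : β ∈ Sig) : w β ∈ Sig := by
  revert β
  refine weylGroup_induction (Sig := Sig) (p := fun w => ∀ {β}, β ∈ Sig → w β ∈ Sig) ?_ ?_ hw
  · intro β hβ
    exact hβ
  · intro α hα w ih β hβ
    rw [isometry_mul_apply, rootRefl_apply]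
    exact hR.refl_mem α hα _ (ih hβ)

theorem IsPositiveSystem.subset (hP : IsPositiveSystem Sig Sp) {α : E d} (hα : α ∈ Sp) :
    α ∈ Sig := by
  obtain ⟨v, _, h⟩ := hP
  exact ((h α).1 hα).1

theorem IsPositiveSystem.mem_or_neg_mem (hR : IsReducedSystem Sig) (hP : IsPositiveSystem Sig Sp)
    {α : E d} (hα : α ∈ Sig) : α ∈ Sp ∨ -α ∈ Sp := by
  obtain ⟨v, hv, h⟩ := hP
  rcases lt_or_gt_of_ne (hv α hα) with h1 | h1
  · right
    rw [h]
    exact ⟨hR.neg_mem hα, by rw [inner_neg_left]; linarith⟩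
  · left
    rw [h]
    exact ⟨hα, h1⟩

theorem IsPositiveSystem.neg_notMem (hP : IsPositiveSystem Sig Sp) {α : E d} (hα : α ∈ Sp) :
    -α ∉ Sp := by
  obtain ⟨v, _, h⟩ := hP
  intro h1
  have h2 := ((h _).1 h1).2
  have h3 := ((h _).1 hα).2
  rw [inner_neg_left] at h2
  linarith

theorem IsPositiveSystem.eq_of_smul_eq (hR : IsReducedSystem Sig) (hP : IsPositiveSystem Sig Sp)
    {α β : E d} (hα : α ∈ Sp) (hβ : β ∈ Sp) {t : ℝ} (h : β = t • α) : β = α := by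
  subst h
  rcases hR.eq_one_or α (hP.subset hα) t (hP.subset hβ) with rfl | rfl
  · simp
  · rw [neg_one_smul] at hβ
    exact absurd hβ (hP.neg_notMem hα)

/-- `β` is a nonnegative combination of the vectors in `D`. -/
def InCone (D : Finset (E d)) (β : E d) : Prop :=
  ∃ c : E d → ℝ, (∀ δ ∈ D, 0 ≤ c δ) ∧ β = ∑ δ ∈ D, c δ • δ

/-- A set of positive roots which is simple in the sense needed for the length theory of `W`. -/
structure IsSimpleSystem (Sp D : Finset (E d)) : Prop where
  subset : D ⊆ Sp
  refl_mem : ∀ α ∈ D, ∀ β ∈ Sp, β ≠ α → rootRefl α β ∈ Sp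
  exists_inner_pos : ∀ γ ∈ Sp, ∃ α ∈ D, 0 < ⟪α, γ⟫

theorem exists_isSimpleSystem (hR : IsReducedSystem Sig) (hP : IsPositiveSystem Sig Sp) :
    ∃ D, IsSimpleSystem Sp D := by
  have hne : (Sp.powerset.filter fun D => ∀ β ∈ Sp, InCone D β).Nonempty := by
    refine ⟨Sp, ?_⟩
    rw [Finset.mem_filter]
    refine ⟨by simp, fun β hβ => ⟨fun δ => if δ = β then 1 else 0, ?_, ?_⟩⟩
    · intro δ _
      dsimp only
      split_ifs <;> norm_num
    · simp [hβ]
  obtain ⟨D, hD, hmin⟩ := Finset.exists_min_image _ Finset.card hne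
  rw [Finset.mem_filter, Finset.mem_powerset] at hD
  obtain ⟨hDS, hcone⟩ := hD
  refine ⟨D, hDS, ?_, ?_⟩
  · intro α hα β hβ hβα
    by_contra hneg
    have hαS := hDS hα
    have hmem : rootRefl α β ∈ Sig := by
      rw [rootRefl_apply]
      exact hR.refl_mem α (hP.subset hαS) β (hP.subset hβ)
    have hneg' := (hP.mem_or_neg_mem hR hmem).resolve_left hneg
    obtain ⟨c, hc, hcβ⟩ := hcone β hβ
    obtain ⟨e, he, heβ⟩ := hcone _ hneg'
    set k : ℝ := 2 * ⟪α, β⟫ / ⟪α, α⟫ with hk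
    have hsum : ∑ δ ∈ D.erase α, (c δ + e δ) • δ = (k - (c α + e α)) • α := by
      have h1 : ∑ δ ∈ D, (c δ + e δ) • δ = k • α := by
        simp only [add_smul, Finset.sum_add_distrib]
        rw [← hcβ, ← heβ, rootRefl_apply, reflVec]
        abel
      rw [← Finset.add_sum_erase _ _ hα] at h1
      rw [sub_smul, ← h1]
      abel
    rcases le_or_gt (k - (c α + e α)) 0 with hle | hgt
    · obtain ⟨v, _, hmemv⟩ := id hP
      have hin : ∑ δ ∈ D.erase α, (c δ + e δ) * ⟪δ, v⟫ = (k - (c α + e α)) * ⟪α, v⟫ := by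
        have := congrArg (fun x => ⟪x, v⟫) hsum
        simpa [sum_inner, inner_smul_left] using this
      have hnn : ∀ δ ∈ D.erase α, 0 ≤ (c δ + e δ) * ⟪δ, v⟫ := by
        intro δ hδ
        have hδD := Finset.mem_of_mem_erase hδ
        exact mul_nonneg (add_nonneg (hc δ hδD) (he δ hδD)) ((hmemv δ).1 (hDS hδD)).2.le
      have hz : ∑ δ ∈ D.erase α, (c δ + e δ) * ⟪δ, v⟫ = 0 := by
        refine le_antisymm ?_ (Finset.sum_nonneg hnn)
        rw [hin]
        exact mul_nonpos_of_nonpos_of_nonneg hle ((hmemv α).1 hαS).2.le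
      have hc0 : ∀ δ ∈ D.erase α, c δ = 0 := by
        intro δ hδ
        have h1 := (Finset.sum_eq_zero_iff_of_nonneg hnn).1 hz δ hδ
        have hδD := Finset.mem_of_mem_erase hδ
        have h2 := ((hmemv δ).1 (hDS hδD)).2
        have h3 := (mul_eq_zero.1 h1).resolve_right h2.ne'
        linarith [hc δ hδD, he δ hδD]
      have hβ' : β = c α • α := by
        rw [hcβ, ← Finset.add_sum_erase _ _ hα]
        simp only [add_eq_left]
        exact Finset.sum_eq_zero fun δ hδ => by rw [hc0 δ hδ, zero_smul]
      exact hβα (hP.eq_of_smul_eq hR hαS hβ hβ')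
    · have hαcone : α = ∑ δ ∈ D.erase α, ((k - (c α + e α))⁻¹ * (c δ + e δ)) • δ := by
        simp only [mul_smul, ← Finset.smul_sum]
        rw [hsum, smul_smul, inv_mul_cancel₀ hgt.ne', one_smul]
      have hlt : (D.erase α).card < D.card := Finset.card_erase_lt_of_mem hα
      refine absurd (hmin (D.erase α) ?_) (not_le.2 hlt)
      rw [Finset.mem_filter, Finset.mem_powerset]
      refine ⟨(Finset.erase_subset _ _).trans hDS, fun γ hγ => ?_⟩
      obtain ⟨b, hb, hbγ⟩ := hcone γ hγ
      refine ⟨fun δ => b δ + b α * ((k - (c α + e α))⁻¹ * (c δ + e δ)), ?_, ?_⟩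
      · intro δ hδ
        have hδD := Finset.mem_of_mem_erase hδ
        exact add_nonneg (hb δ hδD) (mul_nonneg (hb α hα)
          (mul_nonneg (inv_nonneg.2 hgt.le) (add_nonneg (hc δ hδD) (he δ hδD))))
      · have hbα := congrArg (fun x => b α • x) hαcone
        simp only [Finset.smul_sum, smul_smul] at hbα
        simp only [add_smul, Finset.sum_add_distrib]
        rw [hbγ, ← Finset.add_sum_erase _ _ hα, hbα]
        exact add_comm _ _
  · intro γ hγ
    obtain ⟨c, hc, hcγ⟩ := hcone γ hγ
    by_contra hcon
    push Not at hcon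
    have h1 : ⟪γ, γ⟫ = ∑ δ ∈ D, c δ * ⟪δ, γ⟫ := by
      have := congrArg (fun x => ⟪x, γ⟫) hcγ
      simp only [sum_inner, inner_smul_left, conj_trivial] at this
      exact this
    have h2 : 0 < ⟪γ, γ⟫ := real_inner_self_pos.2 (hR.ne_zero (hP.subset hγ))
    have h3 : ∑ δ ∈ D, c δ * ⟪δ, γ⟫ ≤ 0 :=
      Finset.sum_nonpos fun δ hδ => mul_nonpos_of_nonneg_of_nonpos (hc δ hδ) (hcon δ hδ)
    linarith

/-- The Weyl group is generated by the simple reflections. -/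
theorem IsSimpleSystem.weylGroup_le (hR : IsReducedSystem Sig) (hP : IsPositiveSystem Sig Sp)
    {D : Finset (E d)} (hD : IsSimpleSystem Sp D) : weylGroup Sig ≤ weylGroup D := by
  have hpos : ∀ γ ∈ Sp, rootRefl γ ∈ weylGroup D := by
    by_contra hcon
    obtain ⟨v, _, hv⟩ := id hP
    have hne : (Sp.filter fun γ => rootRefl γ ∉ weylGroup D).Nonempty := by
      push Not at hcon
      obtain ⟨γ, h1, h2⟩ := hcon
      exact ⟨γ, Finset.mem_filter.2 ⟨h1, h2⟩⟩
    obtain ⟨γ, hγ, hmin⟩ := Finset.exists_min_image _ (fun γ => ⟪γ, v⟫) hne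
    rw [Finset.mem_filter] at hγ
    obtain ⟨hγS, hγW⟩ := hγ
    obtain ⟨α, hα, hαγ⟩ := hD.exists_inner_pos γ hγS
    have hne : γ ≠ α := by
      rintro rfl
      exact hγW (rootRefl_mem_weylGroup hα)
    have hmem := hD.refl_mem α hα γ hγS hne
    have hconj : rootRefl (rootRefl α γ) ∈ weylGroup D := by
      by_contra h
      have h1 := hmin _ (Finset.mem_filter.2 ⟨hmem, h⟩)
      rw [rootRefl_apply, reflVec, inner_sub_left, inner_smul_left] at h1
      have h2 : 0 < ⟪α, α⟫ := real_inner_self_pos.2 (hR.ne_zero (hP.subset (hD.subset hα)))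
      have h3 : 0 < 2 * ⟪α, γ⟫ / ⟪α, α⟫ := by positivity
      have h4 := mul_pos h3 ((hv α).1 (hD.subset hα)).2
      simp only [conj_trivial] at h1
      linarith
    apply hγW
    have h5 := conj_rootRefl (rootRefl α) (rootRefl α γ)
    rw [rootRefl_rootRefl, rootRefl_inv] at h5
    rw [← h5]
    exact mul_mem (mul_mem (rootRefl_mem_weylGroup hα) hconj) (rootRefl_mem_weylGroup hα)
  intro w hw
  refine weylGroup_induction (Sig := Sig) (one_mem _) (fun α hα w ih => mul_mem ?_ ih) hw
  rcases hP.mem_or_neg_mem hR hα with h | h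
  · exact hpos α h
  · rw [← rootRefl_neg]
    exact hpos _ h

/-- The product of the reflections along the vectors of a list. -/
def reflWord (l : List (E d)) : E d ≃ₗᵢ[ℝ] E d := (l.map rootRefl).prod

theorem exists_reflWord {w : E d ≃ₗᵢ[ℝ] E d} (hw : w ∈ weylGroup Sig) :
    ∃ l : List (E d), (∀ α ∈ l, α ∈ Sig) ∧ w = reflWord l := by
  refine weylGroup_induction (Sig := Sig)
    (p := fun w => ∃ l : List (E d), (∀ α ∈ l, α ∈ Sig) ∧ w = reflWord l) ?_ ?_ hw
  · exact ⟨[], by simp, rfl⟩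
  · rintro α hα w ⟨l, hl, rfl⟩
    exact ⟨α :: l, by simpa [hα] using hl, rfl⟩

/-- The exchange condition. -/
theorem IsSimpleSystem.exchange
    {D : Finset (E d)} (hD : IsSimpleSystem Sp D) {α : E d} (hα : α ∈ D) (l : List (E d)) :
    (∀ β ∈ l, β ∈ D) → reflWord l α ∉ Sp →
    ∃ l' : List (E d), (∀ β ∈ l', β ∈ D) ∧ l'.length + 1 = l.length ∧
      reflWord l * rootRefl α = reflWord l' := by
  induction l with
  | nil => intro _ h; exact absurd (hD.subset hα) h
  | cons a l ih =>
    intro hl h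
    have hlD : ∀ β ∈ l, β ∈ D := fun β hβ => hl β (by simp [hβ])
    have hcons : ∀ l : List (E d), reflWord (a :: l) = rootRefl a * reflWord l := fun _ => rfl
    by_cases hpos : reflWord l α ∈ Sp
    · have heq : reflWord l α = a := by
        by_contra hne
        exact h (hD.refl_mem a (hl a (by simp)) _ hpos hne)
      refine ⟨l, hlD, rfl, ?_⟩
      have hconj := conj_rootRefl (reflWord l) α
      rw [heq, mul_inv_eq_iff_eq_mul] at hconj
      rw [hcons, mul_assoc, hconj, ← mul_assoc, rootRefl_mul_self, one_mul]
    · obtain ⟨l', h1, h2, h3⟩ := ih hlD hpos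
      refine ⟨a :: l', ?_, by simp [h2], ?_⟩
      · intro β hβ
        rcases List.mem_cons.1 hβ with rfl | hβ
        · exact hl _ (by simp)
        · exact h1 β hβ
      · rw [hcons, hcons, mul_assoc, h3]

/-- For `λ, Y` in the closed positive chamber, `⟪λ, wY⟫` is maximal at `w = 1`. -/
theorem inner_apply_le (hR : IsReducedSystem Sig) (hP : IsPositiveSystem Sig Sp) {lam Y : E d}
    (hlam : ∀ α ∈ Sp, 0 ≤ ⟪α, lam⟫) (hY : ∀ α ∈ Sp, 0 ≤ ⟪α, Y⟫) {w : E d ≃ₗᵢ[ℝ] E d}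
    (hw : w ∈ weylGroup Sig) : ⟪lam, w Y⟫ ≤ ⟪lam, Y⟫ := by
  obtain ⟨D, hD⟩ := exists_isSimpleSystem hR hP
  obtain ⟨l, hl, rfl⟩ := exists_reflWord (hD.weylGroup_le hR hP hw)
  clear hw
  induction hn : l.length using Nat.strong_induction_on generalizing l with
  | _ n ih =>
    rcases List.eq_nil_or_concat l with rfl | ⟨l', α, rfl⟩
    · exact le_rfl
    · simp only [List.concat_eq_append, List.length_append, List.length_singleton,
        List.mem_append, List.mem_singleton] at hl hn ⊢
      have hl' : ∀ β ∈ l', β ∈ D := fun β hβ => hl β (Or.inl hβ)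
      have hα : α ∈ D := hl α (Or.inr rfl)
      have hw : reflWord (l' ++ [α]) = reflWord l' * rootRefl α := by simp [reflWord]
      by_cases hpos : reflWord l' α ∈ Sp
      · refine le_trans ?_ (ih l'.length (by omega) l' hl' rfl)
        rw [hw, isometry_mul_apply, rootRefl_apply, reflVec, map_sub, map_smul,
          inner_sub_right, inner_smul_right, ← real_inner_comm lam (reflWord l' α)]
        have h1 := hlam _ hpos
        have h2 := hY α (hD.subset hα)
        have h3 : 0 ≤ 2 * ⟪α, Y⟫ / ⟪α, α⟫ :=
          div_nonneg (by linarith) real_inner_self_nonneg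
        have h4 := mul_nonneg h3 h1
        linarith
      · obtain ⟨l'', h1, h2, h3⟩ := hD.exchange hα l' hl' hpos
        rw [hw, h3]
        exact ih l''.length (by omega) l'' h1 rfl

theorem piP_rootRefl (hP : IsPositiveSystem Sig Sp) {D : Finset (E d)}
    (hD : IsSimpleSystem Sp D) {α : E d} (hα : α ∈ D) (x : E d) :
    piP Sp (rootRefl α x) = -piP Sp x := by
  have hαS := hD.subset hα
  have hmaps : ∀ β ∈ Sp.erase α, rootRefl α β ∈ Sp.erase α := by
    intro β hβ
    rw [Finset.mem_erase] at hβ ⊢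
    refine ⟨?_, hD.refl_mem α hα β hβ.2 hβ.1⟩
    intro h
    have h1 := congrArg (rootRefl α) h
    rw [rootRefl_rootRefl, rootRefl_self] at h1
    exact hP.neg_notMem hαS (h1 ▸ hβ.2)
  unfold piP
  rw [← Finset.mul_prod_erase _ _ hαS, ← Finset.mul_prod_erase _ _ hαS, ← neg_mul]
  congr 1
  · rw [← inner_rootRefl_left, rootRefl_self, inner_neg_left]
  · refine Finset.prod_nbij' (rootRefl α) (rootRefl α) hmaps hmaps
      (fun β _ => rootRefl_rootRefl α β) (fun β _ => rootRefl_rootRefl α β) ?_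
    intro β _
    rw [inner_rootRefl_left]

theorem piP_apply (hR : IsReducedSystem Sig) (hP : IsPositiveSystem Sig Sp) {w : E d ≃ₗᵢ[ℝ] E d}
    (hw : w ∈ weylGroup Sig) (x : E d) : piP Sp (w x) = dsign w * piP Sp x := by
  obtain ⟨D, hD⟩ := exists_isSimpleSystem hR hP
  refine weylGroup_induction (p := fun w => piP Sp (w x) = dsign w * piP Sp x) ?_ ?_
    (hD.weylGroup_le hR hP hw)
  · rw [dsign_one, one_mul]
    rfl
  · intro α hα w ih
    rw [isometry_mul_apply, piP_rootRefl hP hD hα, ih, dsign_mul,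
      dsign_rootRefl (hR.ne_zero (hP.subset (hD.subset hα)))]
    ring

theorem dsign_mul_self (hR : IsReducedSystem Sig) {w : E d ≃ₗᵢ[ℝ] E d} (hw : w ∈ weylGroup Sig) :
    dsign w * dsign w = 1 := by
  refine weylGroup_induction (p := fun w => dsign w * dsign w = 1) ?_ ?_ hw
  · rw [dsign_one, one_mul]
  · intro α hα w ih
    rw [dsign_mul, dsign_rootRefl (hR.ne_zero hα)]
    linear_combination ih

end WeylGroup

section AlternatingSum

variable {d : ℕ} {Sig Sp : Finset (E d)}

/-- The alternating sum `∑_w det(w) e^{⟪λ, wY⟫}`. -/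
def altSum (Sig : Finset (E d)) [Fintype ↥(weylGroup Sig)] (p : E d × E d) : ℝ :=
  ∑ w : ↥(weylGroup Sig), dsign w.1 * Real.exp ⟪p.1, w.1 p.2⟫

theorem contDiff_altSum [Fintype ↥(weylGroup Sig)] : ContDiff ℝ ∞ (altSum Sig) := by
  refine ContDiff.sum fun w _ => contDiff_const.mul (Real.contDiff_exp.comp ?_)
  exact contDiff_fst.inner ℝ (w.1.toContinuousLinearEquiv.contDiff.comp contDiff_snd)

theorem rootRefl_eq_self {α x : E d} (h : ⟪α, x⟫ = 0) : rootRefl α x = x := by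
  simp [rootRefl_apply, reflVec, h]

theorem altSum_eq_zero_left [Fintype ↥(weylGroup Sig)] (hR : IsReducedSystem Sig) {α : E d}
    (hα : α ∈ Sig) {p : E d × E d} (h : ⟪α, p.1⟫ = 0) : altSum Sig p = 0 := by
  have h1 : altSum Sig p = -altSum Sig p := by
    conv_lhs =>
      rw [altSum, ← Equiv.sum_comp (Equiv.mulLeft (⟨rootRefl α, rootRefl_mem_weylGroup hα⟩ :
        ↥(weylGroup Sig)))]
    rw [altSum, ← Finset.sum_neg_distrib]
    refine Finset.sum_congr rfl fun w _ => ?_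
    rw [Equiv.coe_mulLeft, Subgroup.coe_mul, dsign_mul, dsign_rootRefl (hR.ne_zero hα),
      isometry_mul_apply, ← inner_rootRefl_left, rootRefl_eq_self h]
    ring
  linarith

theorem altSum_eq_zero_right [Fintype ↥(weylGroup Sig)] (hR : IsReducedSystem Sig) {α : E d}
    (hα : α ∈ Sig) {p : E d × E d} (h : ⟪α, p.2⟫ = 0) : altSum Sig p = 0 := by
  have h1 : altSum Sig p = -altSum Sig p := by
    conv_lhs =>
      rw [altSum, ← Equiv.sum_comp (Equiv.mulRight (⟨rootRefl α, rootRefl_mem_weylGroup hα⟩ :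
        ↥(weylGroup Sig)))]
    rw [altSum, ← Finset.sum_neg_distrib]
    refine Finset.sum_congr rfl fun w _ => ?_
    rw [Equiv.coe_mulRight, Subgroup.coe_mul, dsign_mul, dsign_rootRefl (hR.ne_zero hα),
      isometry_mul_apply, rootRefl_eq_self h]
    ring
  linarith

/-- The linear forms on `ℝ^d × ℝ^d` given by pairing a vector with one of the two factors. -/
def pairForm : E d ⊕ E d → (E d × E d →L[ℝ] ℝ) :=
  Sum.elim (fun α => (innerSL ℝ α).comp (ContinuousLinearMap.fst ℝ (E d) (E d)))
    (fun α => (innerSL ℝ α).comp (ContinuousLinearMap.snd ℝ (E d) (E d)))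

theorem pairForm_inl (α : E d) (p : E d × E d) : pairForm (Sum.inl α) p = ⟪α, p.1⟫ := rfl

theorem pairForm_inr (α : E d) (p : E d × E d) : pairForm (Sum.inr α) p = ⟪α, p.2⟫ := rfl

theorem prod_pairForm (Sp : Finset (E d)) (p : E d × E d) :
    ∏ i ∈ Sp.disjSum Sp, pairForm i p = piP Sp p.1 * piP Sp p.2 := by
  simp [Finset.prod_disjSum, pairForm_inl, pairForm_inr, piP]

theorem pairForm_ne_zero (hR : IsReducedSystem Sig) (hP : IsPositiveSystem Sig Sp) :
    ∀ i ∈ Sp.disjSum Sp, ∃ y, pairForm i y ≠ 0 := by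
  rintro (α | α) hi
  · have hα : α ≠ 0 := hR.ne_zero (hP.subset (Finset.inl_mem_disjSum.1 hi))
    exact ⟨(α, 0), by rw [pairForm_inl]; exact (real_inner_self_pos.2 hα).ne'⟩
  · have hα : α ≠ 0 := hR.ne_zero (hP.subset (Finset.inr_mem_disjSum.1 hi))
    exact ⟨(0, α), by rw [pairForm_inr]; exact (real_inner_self_pos.2 hα).ne'⟩

theorem IsPositiveSystem.exists_inner_eq_zero (hR : IsReducedSystem Sig)
    (hP : IsPositiveSystem Sig Sp) {α β : E d} (hα : α ∈ Sp) (hβ : β ∈ Sp) (hne : α ≠ β) :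
    ∃ y : E d, ⟪α, y⟫ = 0 ∧ ⟪β, y⟫ ≠ 0 := by
  have hα0 : ⟪α, α⟫ ≠ 0 := (real_inner_self_pos.2 (hR.ne_zero (hP.subset hα))).ne'
  set c : ℝ := ⟪α, β⟫ / ⟪α, α⟫ with hc
  have h1 : ⟪α, β - c • α⟫ = 0 := by
    rw [inner_sub_right, inner_smul_right, hc, div_mul_cancel₀ _ hα0, sub_self]
  refine ⟨β - c • α, h1, fun h2 => hne ?_⟩
  have h3 : ⟪β - c • α, β - c • α⟫ = 0 := by
    rw [inner_sub_left, inner_smul_left, h1, h2]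
    simp
  exact (hP.eq_of_smul_eq hR hα hβ (sub_eq_zero.1 (inner_self_eq_zero.1 h3))).symm

theorem exists_contDiff_altSum_eq [Fintype ↥(weylGroup Sig)] (hR : IsReducedSystem Sig)
    (hP : IsPositiveSystem Sig Sp) :
    ∃ Φ : E d × E d → ℝ, ContDiff ℝ ∞ Φ ∧
      ∀ p, altSum Sig p = piP Sp p.1 * piP Sp p.2 * Φ p := by
  have hpair : ∀ i ∈ Sp.disjSum Sp, ∀ j ∈ Sp.disjSum Sp, i ≠ j →
      ∃ y, pairForm i y = 0 ∧ pairForm j y ≠ 0 := by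
    rintro (α | α) hi (β | β) hj hne
    · obtain ⟨y, h1, h2⟩ := hP.exists_inner_eq_zero hR (Finset.inl_mem_disjSum.1 hi)
        (Finset.inl_mem_disjSum.1 hj) (fun h => hne (congrArg _ h))
      exact ⟨(y, 0), h1, h2⟩
    · have hβ : β ≠ 0 := hR.ne_zero (hP.subset (Finset.inr_mem_disjSum.1 hj))
      exact ⟨(0, β), inner_zero_right α, (real_inner_self_pos.2 hβ).ne'⟩
    · have hβ : β ≠ 0 := hR.ne_zero (hP.subset (Finset.inl_mem_disjSum.1 hj))
      exact ⟨(β, 0), inner_zero_right α, (real_inner_self_pos.2 hβ).ne'⟩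
    · obtain ⟨y, h1, h2⟩ := hP.exists_inner_eq_zero hR (Finset.inr_mem_disjSum.1 hi)
        (Finset.inr_mem_disjSum.1 hj) (fun h => hne (congrArg _ h))
      exact ⟨(0, y), h1, h2⟩
  have hzero : ∀ i ∈ Sp.disjSum Sp, ∀ p, pairForm i p = 0 → altSum Sig p = 0 := by
    rintro (α | α) hi p hp
    · exact altSum_eq_zero_left hR (hP.subset (Finset.inl_mem_disjSum.1 hi)) hp
    · exact altSum_eq_zero_right hR (hP.subset (Finset.inr_mem_disjSum.1 hi)) hp
  obtain ⟨Φ, h1, h2⟩ := exists_contDiff_eq_prod_mul pairForm contDiff_altSum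
    (Sp.disjSum Sp) (pairForm_ne_zero hR hP) hpair hzero
  exact ⟨Φ, h1, fun p => by rw [h2, prod_pairForm]⟩

theorem eq_of_continuous_of_eq_on_regular (hR : IsReducedSystem Sig)
    (hP : IsPositiveSystem Sig Sp) {Φ Ψ : E d × E d → ℝ} (hΦ : Continuous Φ) (hΨ : Continuous Ψ)
    (h : ∀ p : E d × E d, piP Sp p.1 * piP Sp p.2 ≠ 0 → Φ p = Ψ p) : Φ = Ψ := by
  funext p
  refine sub_eq_zero.1 (eq_zero_of_prod_mul_eq_zero_on pairForm ⊤ (Sp.disjSum Sp)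
    (h := fun p => Φ p - Ψ p) (hΦ.sub hΨ) ?_ ?_ p trivial)
  · intro i hi
    obtain ⟨y, hy⟩ := pairForm_ne_zero hR hP i hi
    exact ⟨y, trivial, hy⟩
  · intro x _
    rw [prod_pairForm]
    by_cases hx : piP Sp x.1 * piP Sp x.2 = 0
    · rw [hx, zero_mul]
    · rw [h x hx, sub_self, mul_zero]

theorem piP_sdiff_mul {S T : Finset (E d)} (h : S ⊆ T) (x : E d) :
    piP T x = piP S x * piP (T \ S) x := by
  rw [mul_comm]
  exact (Finset.prod_sdiff h).symm

theorem sum_dsign_piP_mul_exp [Fintype ↥(weylGroup Sig)] {Φ : E d × E d → ℝ}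
    (hΦ : ContDiff ℝ ∞ Φ) (hΦN : ∀ p, altSum Sig p = piP Sp p.1 * piP Sp p.2 * Φ p)
    {S : Finset (E d)} (hS : S ⊆ Sp) {lam : E d} (hlam : ∀ α ∈ S, ⟪α, lam⟫ = 0) (Y : E d) :
    ∑ w : ↥(weylGroup Sig), dsign w.1 * (piP S (w.1 Y) * Real.exp ⟪lam, w.1 Y⟫) =
      cConst S * (piP (Sp \ S) lam * (piP Sp Y * Φ (lam, Y))) := by
  have hexp : ∀ u : E d, ContDiff ℝ ∞ fun x : E d => Real.exp ⟪u, x⟫ := fun u =>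
    Real.contDiff_exp.comp (contDiff_inner_const u)
  have hfun : (fun x : E d => ∑ w : ↥(weylGroup Sig), dsign w.1 * Real.exp ⟪w.1 Y, x⟫) =
      fun x => piP S x * (piP (Sp \ S) x * (piP Sp Y * Φ (x, Y))) := by
    funext x
    have := hΦN (x, Y)
    dsimp only [altSum] at this
    simp only [real_inner_comm]
    rw [this, piP_sdiff_mul hS x]
    ring
  have hD := congrArg (fun f => Dop S.toList f lam) hfun
  rw [Dop_piP_mul hlam (G := fun x => piP (Sp \ S) x * (piP Sp Y * Φ (x, Y)))
    ((contDiff_piP _).mul (contDiff_const.mul (hΦ.comp (contDiff_id.prodMk contDiff_const)))),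
    Dop_sum _ fun w => contDiff_const.mul (hexp _)] at hD
  rw [← hD]
  refine Finset.sum_congr rfl fun w _ => ?_
  rw [Dop_const_mul (hexp _), Dop_exp_inner]
  dsimp only
  rw [Finset.prod_map_toList, real_inner_comm]
  rfl

end AlternatingSum

section Stabilizer

variable {d : ℕ} {Sig Sp : Finset (E d)}

/-- The vectors of `S` orthogonal to `X`. -/
def orthRoots (S : Finset (E d)) (X : E d) : Finset (E d) := S.filter fun α => ⟪α, X⟫ = 0

theorem mem_orthRoots {S : Finset (E d)} {X α : E d} :
    α ∈ orthRoots S X ↔ α ∈ S ∧ ⟪α, X⟫ = 0 := Finset.mem_filter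

theorem orthRoots_subset (S : Finset (E d)) (X : E d) : orthRoots S X ⊆ S :=
  Finset.filter_subset _ _

theorem IsReducedSystem.orthRoots (hR : IsReducedSystem Sig) (X : E d) :
    IsReducedSystem (orthRoots Sig X) where
  zero_notMem h := hR.zero_notMem (mem_orthRoots.1 h).1
  eq_one_or α hα t ht := hR.eq_one_or α (mem_orthRoots.1 hα).1 t (mem_orthRoots.1 ht).1
  refl_mem α hα β hβ := by
    rw [mem_orthRoots] at hα hβ ⊢
    refine ⟨hR.refl_mem α hα.1 β hβ.1, ?_⟩
    rw [reflVec, inner_sub_left, inner_smul_left, hα.2, hβ.2, mul_zero, sub_zero]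

theorem IsPositiveSystem.orthRoots (hP : IsPositiveSystem Sig Sp) (X : E d) :
    IsPositiveSystem (orthRoots Sig X) (orthRoots Sp X) := by
  obtain ⟨v, h1, h2⟩ := hP
  refine ⟨v, fun α hα => h1 α (mem_orthRoots.1 hα).1, fun α => ?_⟩
  rw [mem_orthRoots, mem_orthRoots, h2]
  tauto

theorem IsPositiveSystem.exists_piP_ne_zero (hP : IsPositiveSystem Sig Sp) :
    ∃ v : E d, piP Sp v ≠ 0 := by
  obtain ⟨v, _, h⟩ := hP
  exact ⟨v, Finset.prod_ne_zero_iff.2 fun α hα => ((h α).1 hα).2.ne'⟩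

theorem IsPositiveSystem.cConst_ne_zero [Fintype ↥(weylGroup Sig)] (hR : IsReducedSystem Sig)
    (hP : IsPositiveSystem Sig Sp) : cConst Sp ≠ 0 := by
  intro h0
  obtain ⟨Φ, hΦ, hΦN⟩ := exists_contDiff_altSum_eq hR hP
  obtain ⟨v, hv⟩ := hP.exists_piP_ne_zero
  have h := sum_dsign_piP_mul_exp hΦ hΦN (Finset.Subset.refl Sp) (lam := 0)
    (fun α _ => inner_zero_right α) v
  have hterm : ∀ w : ↥(weylGroup Sig),
      dsign w.1 * (piP Sp (w.1 v) * Real.exp ⟪(0 : E d), w.1 v⟫) = piP Sp v := by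
    intro w
    rw [piP_apply hR hP w.2, inner_zero_left, Real.exp_zero]
    linear_combination piP Sp v * dsign_mul_self hR w.2
  rw [h0, zero_mul, Finset.sum_congr rfl fun w _ => hterm w, Finset.sum_const, nsmul_eq_mul] at h
  exact mul_ne_zero (Nat.cast_ne_zero.2 (Finset.card_pos.2 Finset.univ_nonempty).ne') hv h

theorem cConst_orthRoots_ne_zero [Fintype ↥(weylGroup Sig)] (hR : IsReducedSystem Sig)
    (hP : IsPositiveSystem Sig Sp) (X : E d) : cConst (orthRoots Sp X) ≠ 0 := by
  have hle : weylGroup (orthRoots Sig X) ≤ weylGroup Sig :=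
    Subgroup.closure_mono fun w ⟨α, hα, h⟩ => ⟨α, orthRoots_subset Sig X hα, h⟩
  have : Fintype ↥(weylGroup (orthRoots Sig X)) :=
    Fintype.ofInjective _ (Subgroup.inclusion_injective hle)
  exact (hP.orthRoots X).cConst_ne_zero (hR.orthRoots X)

theorem apply_inv_eq_self {w : E d ≃ₗᵢ[ℝ] E d} {X : E d} (h : w X = X) : w⁻¹ X = X := by
  conv_lhs => rw [← h]
  exact w.symm_apply_apply X

theorem dsign_inv (hR : IsReducedSystem Sig) {w : E d ≃ₗᵢ[ℝ] E d} (hw : w ∈ weylGroup Sig) :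
    dsign w⁻¹ = dsign w := by
  have h1 : dsign w⁻¹ * dsign w = 1 := by rw [← dsign_mul, inv_mul_cancel, dsign_one]
  linear_combination dsign w * h1 - dsign w⁻¹ * dsign_mul_self hR hw

theorem apply_mem_sdiff_orthRoots (hR : IsReducedSystem Sig) (hP : IsPositiveSystem Sig Sp)
    {X : E d} (hX : ∀ α ∈ Sp, 0 ≤ ⟪α, X⟫) {w : E d ≃ₗᵢ[ℝ] E d}
    (hw : w ∈ weylGroup Sig) (hwX : w X = X)
    {α : E d} (hα : α ∈ Sp \ orthRoots Sp X) : w α ∈ Sp \ orthRoots Sp X := by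
  rw [Finset.mem_sdiff, mem_orthRoots] at hα ⊢
  have h1 : ⟪α, X⟫ ≠ 0 := fun h => hα.2 ⟨hα.1, h⟩
  have h2 : ⟪w α, X⟫ = ⟪α, X⟫ := by
    conv_lhs => rw [← hwX]
    exact w.inner_map_map α X
  refine ⟨?_, fun h => h1 (h2 ▸ h.2)⟩
  refine (hP.mem_or_neg_mem hR (hR.apply_mem hw (hP.subset hα.1))).resolve_right fun h => ?_
  have h3 := hX _ h
  rw [inner_neg_left, h2] at h3
  exact h1 (le_antisymm (by linarith) (hX α hα.1))

theorem piP_orthRoots_apply (hR : IsReducedSystem Sig) (hP : IsPositiveSystem Sig Sp)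
    {X : E d} (hX : ∀ α ∈ Sp, 0 ≤ ⟪α, X⟫) {w : E d ≃ₗᵢ[ℝ] E d}
    (hw : w ∈ weylGroup Sig) (hwX : w X = X)
    (x : E d) : piP (orthRoots Sp X) (w x) = dsign w * piP (orthRoots Sp X) x := by
  have hinv : ∀ x, piP (Sp \ orthRoots Sp X) (w x) = piP (Sp \ orthRoots Sp X) x := by
    intro x
    refine Finset.prod_nbij' (fun α => w⁻¹ α) (fun α => w α)
      (fun α hα => apply_mem_sdiff_orthRoots hR hP hX (inv_mem hw) (apply_inv_eq_self hwX) hα)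
      (fun α hα => apply_mem_sdiff_orthRoots hR hP hX hw hwX hα)
      (fun α _ => w.apply_symm_apply α) (fun α _ => w.symm_apply_apply α) ?_
    intro α _
    rw [inner_inv_apply]
  have hc : Continuous (piP (orthRoots Sp X)) := (contDiff_piP _).continuous
  refine sub_eq_zero.1 (eq_zero_of_prod_mul_eq_zero_on (fun α => innerSL ℝ α) ⊤
    (Sp \ orthRoots Sp X)
    (h := fun x => piP (orthRoots Sp X) (w x) - dsign w * piP (orthRoots Sp X) x)
    ((hc.comp w.continuous).sub (continuous_const.mul hc)) ?_ ?_ x trivial)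
  · intro α hα
    have hα0 := hR.ne_zero (hP.subset (Finset.mem_sdiff.1 hα).1)
    exact ⟨α, trivial, (real_inner_self_pos.2 hα0).ne'⟩
  · intro y _
    have h1 := piP_apply hR hP hw y
    rw [piP_sdiff_mul (orthRoots_subset Sp X), piP_sdiff_mul (orthRoots_subset Sp X) y,
      hinv] at h1
    change piP (Sp \ orthRoots Sp X) y * _ = 0
    linear_combination h1

theorem Dop_map_orthRoots (hR : IsReducedSystem Sig) (hP : IsPositiveSystem Sig Sp)
    {X : E d} (hX : ∀ α ∈ Sp, 0 ≤ ⟪α, X⟫) {w : E d ≃ₗᵢ[ℝ] E d}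
    (hw : w ∈ weylGroup Sig) (hwX : w X = X)
    {f : E d → ℝ} (hf : ContDiff ℝ ∞ f) (x : E d) :
    Dop ((orthRoots Sp X).toList.map w) f x = dsign w * Dop (orthRoots Sp X).toList f x := by
  set S := orthRoots Sp X with hS
  have hmem : ∀ α ∈ S, w α ∈ S ∨ -w α ∈ S := by
    intro α hα
    rw [hS, mem_orthRoots] at hα
    have h1 : ⟪w α, X⟫ = 0 := by
      rw [← hα.2]
      conv_lhs => rw [← hwX]
      exact w.inner_map_map α X
    rw [hS, mem_orthRoots, mem_orthRoots]
    refine (hP.mem_or_neg_mem hR (hR.apply_mem hw (hP.subset hα.1))).imp (fun h => ⟨h, h1⟩)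
      fun h => ⟨h, ?_⟩
    rw [inner_neg_left, h1, neg_zero]
  set e : E d → ℝ := fun α => if w α ∈ S then 1 else -1 with he
  set s : E d → E d := fun α => e α • w α with hs
  have hee : ∀ α, e α * e α = 1 := by
    intro α
    simp only [he]
    split_ifs <;> norm_num
  have hes : ∀ α, w α = e α • s α := by
    intro α
    simp only [hs]
    rw [smul_smul, hee, one_smul]
  have hsS : ∀ α ∈ S, s α ∈ S := by
    intro α hα
    simp only [hs, he]
    split_ifs with h
    · rwa [one_smul]
    · rw [neg_one_smul]
      exact (hmem α hα).resolve_left h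
  have hinj : Set.InjOn s S := by
    intro α hα β hβ hab
    have h1 : w α = w ((e α * e β) • β) := by
      rw [map_smul, hes α, hab, mul_smul]
    exact hP.eq_of_smul_eq hR (orthRoots_subset _ _ hβ) (orthRoots_subset _ _ hα)
      (w.injective h1)
  have himg : S.image s = S :=
    Finset.eq_of_subset_of_card_le (Finset.image_subset_iff.2 hsS)
      (Finset.card_image_of_injOn hinj).ge
  have hperm : (S.toList.map s).Perm S.toList := by
    rw [← Multiset.coe_eq_coe, ← Multiset.map_coe, Finset.coe_toList]
    conv_rhs => rw [← himg, Finset.image_val_of_injOn hinj]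
  have heps : ∏ α ∈ S, e α = dsign w := by
    obtain ⟨v, hv⟩ := (hP.orthRoots X).exists_piP_ne_zero
    have h1 := piP_orthRoots_apply hR hP hX (inv_mem hw) (apply_inv_eq_self hwX) v
    rw [dsign_inv hR hw] at h1
    refine mul_right_cancel₀ hv (h1 ▸ ?_)
    have hprod : piP S v = ∏ α ∈ S, ⟪s α, v⟫ := by
      rw [piP]
      conv_lhs => rw [← himg, Finset.prod_image hinj]
    rw [← hS, hprod, piP, ← Finset.prod_mul_distrib]
    refine Finset.prod_congr rfl fun α _ => ?_
    rw [real_inner_comm (w⁻¹ v), inner_inv_apply, real_inner_comm]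
    conv_rhs => rw [hes α, inner_smul_right]
  have hmap : S.toList.map w = S.toList.map fun α => e α • s α :=
    List.map_congr_left fun α _ => hes α
  rw [hmap, Dop_map_smul hf, Dop_perm hf hperm, Finset.prod_map_toList, heps]

end Stabilizer

section Asymptotics

variable {d : ℕ} {Sig Sp : Finset (E d)}

/-- The product formula for two subgroups `H`, `K` of a finite group. -/
theorem Subgroup.card_filter_mul {G : Type*} [Group G] [Fintype G] (H K : Subgroup G) :
    (Finset.univ.filter fun g : G => ∃ a ∈ H, ∃ b ∈ K, g = a * b).card *
        (Finset.univ.filter fun g : G => g ∈ H ∧ g ∈ K).card =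
      (Finset.univ.filter fun g : G => g ∈ H).card *
        (Finset.univ.filter fun g : G => g ∈ K).card := by
  symm
  rw [← Finset.card_product, Finset.card_eq_sum_card_fiberwise (f := fun p : G × G => p.1 * p.2)
    (t := Finset.univ.filter fun g : G => ∃ a ∈ H, ∃ b ∈ K, g = a * b)]
  · refine Finset.sum_const_nat fun g hg => ?_
    obtain ⟨a, ha, b, hb, rfl⟩ := (Finset.mem_filter.1 hg).2
    refine Finset.card_nbij' (fun p => a⁻¹ * p.1) (fun c => (a * c, c⁻¹ * b)) ?_ ?_ ?_ ?_
    · rintro ⟨x, y⟩ hp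
      simp only [Finset.coe_filter, Finset.mem_product, Finset.mem_filter, Finset.mem_univ,
        true_and, Set.mem_ofPred_eq] at hp ⊢
      refine ⟨H.mul_mem (H.inv_mem ha) hp.1.1, ?_⟩
      rw [eq_mul_inv_of_mul_eq hp.2, mul_assoc, inv_mul_cancel_left]
      exact K.mul_mem hb (K.inv_mem hp.1.2)
    · intro c hc
      simp only [Finset.coe_filter, Finset.mem_univ, true_and, Set.mem_ofPred_eq] at hc
      simp [H.mul_mem ha hc.1, K.mul_mem (K.inv_mem hc.2) hb, mul_assoc]
    · rintro ⟨x, y⟩ hp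
      simp only [Finset.coe_filter, Finset.mem_product, Finset.mem_filter, Finset.mem_univ,
        true_and, Set.mem_ofPred_eq] at hp
      simp [mul_assoc, ← hp.2]
    · intro c _
      simp
  · rintro ⟨a, b⟩ hp
    simp only [Finset.coe_product, Finset.coe_filter, Finset.mem_univ, true_and, Set.mem_prod,
      Set.mem_ofPred_eq] at hp ⊢
    exact ⟨a, hp.1, b, hp.2, rfl⟩

/-- `π_S(x) e^{⟪u, x⟫}`. -/
def piExp (S : Finset (E d)) (u x : E d) : ℝ := piP S x * Real.exp ⟪u, x⟫

theorem contDiff_exp_inner (u : E d) : ContDiff ℝ ∞ fun x : E d => Real.exp ⟪u, x⟫ :=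
  Real.contDiff_exp.comp (contDiff_inner_const u)

theorem contDiff_piExp (S : Finset (E d)) (u : E d) : ContDiff ℝ ∞ (piExp S u) :=
  (contDiff_piP S).mul (contDiff_exp_inner u)

theorem tendsto_Dop_piExp {S T : Finset (E d)} {u X : E d} (hS : ∀ α ∈ S, ⟪α, u⟫ = 0)
    (hT : ∀ α ∈ T, ⟪α, X⟫ = 0) :
    Filter.Tendsto (fun t : ℝ => Dop T.toList (piExp S u) (t • X) / t ^ (S \ T).card *
      Real.exp (-(t * ⟪u, X⟫))) Filter.atTop
      (𝓝 (piP (T \ S) u * (cConst (S ∩ T) * piP (S \ T) X))) := by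
  have hperm : T.toList.Perm ((T \ S).toList ++ (S ∩ T).toList) := by
    refine (List.perm_ext_iff_of_nodup T.nodup_toList ?_).2 fun α => ?_
    · refine List.Nodup.append (Finset.nodup_toList _) (Finset.nodup_toList _) ?_
      intro α h1 h2
      simp only [Finset.mem_toList, Finset.mem_sdiff, Finset.mem_inter] at h1 h2
      exact h1.2 h2.1
    · simp only [List.mem_append, Finset.mem_toList, Finset.mem_sdiff, Finset.mem_inter]
      tauto
  have hcard : S.card = (S \ T).card + (S ∩ T).toList.length := by
    rw [Finset.length_toList, Finset.card_sdiff_add_card_inter]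
  have hlead : Dop (S ∩ T).toList (piP S) X = cConst (S ∩ T) * piP (S \ T) X := by
    have h1 : piP S = fun x => piP (S ∩ T) x * piP (S \ T) x := by
      funext x
      exact (Finset.prod_inter_mul_prod_sdiff S T _).symm
    rw [h1]
    exact Dop_piP_mul (fun α hα => hT α (Finset.mem_inter.1 hα).2) (contDiff_piP _)
  have hfun : Dop T.toList (piExp S u) =
      Dop (T \ S).toList fun x => Dop (S ∩ T).toList (piP S) x * Real.exp ⟪u, x⟫ := by
    rw [Dop_perm (contDiff_piExp S u) hperm, Dop_append]
    congr 1
    refine Dop_mul_of_fderiv_eq_zero (contDiff_piP S) (contDiff_exp_inner u) _ fun v hv x => ?_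
    rw [fderiv_exp_inner, real_inner_comm, hS v (Finset.mem_inter.1 (Finset.mem_toList.1 hv)).1,
      zero_mul]
  have hgrow := GrowsAlong.of_homogeneous (contDiff_piP S) (S ∩ T).toList
    (fun c x => by rw [← hcard, piP_smul]) X
  have h := hgrow.Dop_mul_exp (u := u) (T \ S).toList (contDiff_Dop (contDiff_piP S) _)
  rw [Finset.prod_map_toList, hlead, ← hfun] at h
  exact h

theorem tendsto_Dop_piExp_zero (S : Finset (E d)) (L : List (E d)) {u X : E d} {a : ℝ}
    (ha : ⟪u, X⟫ < a) (j : ℕ) :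
    Filter.Tendsto (fun t : ℝ => Dop L (piExp S u) (t • X) / t ^ j *
      Real.exp (-(t * a))) Filter.atTop (𝓝 0) := by
  have hgrow := GrowsAlong.of_homogeneous (j := S.card) (contDiff_piP S) []
    (fun c x => by rw [List.length_nil, add_zero, piP_smul]) X
  have h := hgrow.Dop_mul_exp (u := u) L (contDiff_piP S)
  have hdec : Filter.Tendsto (fun t : ℝ => t ^ S.card * Real.exp (-(a - ⟪u, X⟫) * t))
      Filter.atTop (𝓝 0) := by
    simpa using tendsto_rpow_mul_exp_neg_mul_atTop_nhds_zero S.card (a - ⟪u, X⟫) (by linarith)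
  have hinv : Filter.Tendsto (fun t : ℝ => (t ^ S.card * Real.exp (-(a - ⟪u, X⟫) * t)) / t ^ j)
      Filter.atTop (𝓝 0) := by
    refine squeeze_zero_norm' ?_ hdec
    filter_upwards [Filter.eventually_ge_atTop 1] with t ht
    rw [Real.norm_of_nonneg (by positivity)]
    exact div_le_self (by positivity) (one_le_pow₀ ht)
  have hmul := h.mul hinv
  rw [mul_zero] at hmul
  refine hmul.congr' ?_
  filter_upwards [Filter.eventually_gt_atTop 0] with t ht
  have hexp : Real.exp (-(t * a)) =
      Real.exp (-(t * ⟪u, X⟫)) * Real.exp (-(a - ⟪u, X⟫) * t) := by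
    rw [← Real.exp_add]
    congr 1
    ring
  rw [hexp]
  change Dop L (piExp S u) (t • X) / t ^ S.card * Real.exp (-(t * ⟪u, X⟫)) * _ = _
  field_simp

theorem Dop_comp_isometry {f : E d → ℝ} (hf : ContDiff ℝ ∞ f) (w : E d ≃ₗᵢ[ℝ] E d)
    (L : List (E d)) (x : E d) : Dop L (fun y => f (w y)) x = Dop (L.map w) f (w x) :=
  congrFun (Dop_comp_clm hf w.toContinuousLinearEquiv.toContinuousLinearMap L) x

theorem sum_dsign_Dop_piExp [Fintype ↥(weylGroup Sig)] {Φ : E d × E d → ℝ}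
    (hΦ : ContDiff ℝ ∞ Φ) (hΦN : ∀ p, altSum Sig p = piP Sp p.1 * piP Sp p.2 * Φ p)
    {S T : Finset (E d)} (hS : S ⊆ Sp) (hT : T ⊆ Sp) {lam Y : E d}
    (hlam : ∀ α ∈ S, ⟪α, lam⟫ = 0) (hY : ∀ α ∈ T, ⟪α, Y⟫ = 0) :
    ∑ w : ↥(weylGroup Sig), dsign w.1 * Dop T.toList (fun y => piExp S lam (w.1 y)) Y =
      cConst T * (cConst S * (piP (Sp \ S) lam * (piP (Sp \ T) Y * Φ (lam, Y)))) := by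
  have hw : ∀ w : ↥(weylGroup Sig), ContDiff ℝ ∞ fun y => piExp S lam (w.1 y) := fun w =>
    (contDiff_piExp S lam).comp w.1.toContinuousLinearEquiv.contDiff
  have hfun : (fun y => ∑ w : ↥(weylGroup Sig), dsign w.1 * piExp S lam (w.1 y)) =
      fun y => piP T y * (cConst S * (piP (Sp \ S) lam * (piP (Sp \ T) y * Φ (lam, y)))) := by
    funext y
    have := sum_dsign_piP_mul_exp hΦ hΦN hS hlam y
    rw [piP_sdiff_mul hT y] at this
    exact this.trans (by ring)
  have hD := congrArg (fun f => Dop T.toList f Y) hfun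
  rw [Dop_piP_mul hY (G := fun y => cConst S * (piP (Sp \ S) lam * (piP (Sp \ T) y * Φ (lam, y))))
    (contDiff_const.mul (contDiff_const.mul ((contDiff_piP _).mul
      (hΦ.comp (contDiff_const.prodMk contDiff_id))))),
    Dop_sum _ fun w => contDiff_const.mul (hw w)] at hD
  rw [← hD]
  refine Finset.sum_congr rfl fun w _ => ?_
  rw [Dop_const_mul (hw w)]

theorem dsign_mul_Dop_piExp_mul (hR : IsReducedSystem Sig) (hP : IsPositiveSystem Sig Sp)
    {lam Y : E d} (hlam : ∀ α ∈ Sp, 0 ≤ ⟪α, lam⟫) (hY : ∀ α ∈ Sp, 0 ≤ ⟪α, Y⟫)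
    {w₁ w₂ : E d ≃ₗᵢ[ℝ] E d} (h₁ : w₁ ∈ weylGroup Sig) (h₂ : w₂ ∈ weylGroup Sig)
    (hw₁ : w₁ lam = lam) (hw₂ : w₂ Y = Y) (t : ℝ) :
    dsign (w₁ * w₂) * Dop (orthRoots Sp Y).toList
        (fun y => piExp (orthRoots Sp lam) lam ((w₁ * w₂) y)) (t • Y) =
      Dop (orthRoots Sp Y).toList (piExp (orthRoots Sp lam) lam) (t • Y) := by
  have hf := contDiff_piExp (orthRoots Sp lam) lam
  have hfun : (fun y => piExp (orthRoots Sp lam) lam ((w₁ * w₂) y)) =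
      fun y => dsign w₁ * piExp (orthRoots Sp lam) lam (w₂ y) := by
    funext y
    rw [isometry_mul_apply, piExp, piExp, piP_orthRoots_apply hR hP hlam h₁ hw₁,
      ← inner_inv_apply, apply_inv_eq_self hw₁, mul_assoc]
  have hfw : ContDiff ℝ ∞ fun y => piExp (orthRoots Sp lam) lam (w₂ y) :=
    hf.comp w₂.toContinuousLinearEquiv.contDiff
  rw [hfun, Dop_const_mul hfw]
  beta_reduce
  rw [Dop_comp_isometry hf, map_smul, hw₂, Dop_map_orthRoots hR hP hY h₂ hw₂ hf, dsign_mul]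
  linear_combination dsign w₂ * dsign w₂ * Dop (orthRoots Sp Y).toList
      (piExp (orthRoots Sp lam) lam) (t • Y) * dsign_mul_self hR h₁ +
    Dop (orthRoots Sp Y).toList (piExp (orthRoots Sp lam) lam) (t • Y) * dsign_mul_self hR h₂

end Asymptotics

section SphericalAsymptotics

variable {d : ℕ} {Sig Sp : Finset (E d)}

/-- The stabilizer of `X` in the Weyl group. -/
def weylStabilizer (Sig : Finset (E d)) (X : E d) : Subgroup ↥(weylGroup Sig) where
  carrier := {w | w.1 X = X}
  one_mem' := rfl
  mul_mem' {a b} ha hb := by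
    change a.1 (b.1 X) = X
    rw [show b.1 X = X from hb, show a.1 X = X from ha]
  inv_mem' h := apply_inv_eq_self h

theorem mem_weylStabilizer {X : E d} {w : ↥(weylGroup Sig)} :
    w ∈ weylStabilizer Sig X ↔ w.1 X = X := Iff.rfl

theorem piP_sdiff_orthRoots_ne_zero (Sp : Finset (E d)) (X : E d) :
    piP (Sp \ orthRoots Sp X) X ≠ 0 := by
  refine Finset.prod_ne_zero_iff.2 fun α hα h => ?_
  rw [Finset.mem_sdiff] at hα
  exact hα.2 (mem_orthRoots.2 ⟨hα.1, h⟩)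

theorem disjoint_sdiff_union (Sp S T : Finset (E d)) : Disjoint (Sp \ (S ∪ T)) (T \ S) :=
  Finset.disjoint_left.2 fun _ h1 h2 => (Finset.mem_sdiff.1 h1).2
    (Finset.mem_union_right S (Finset.mem_sdiff.1 h2).1)

theorem sdiff_eq_union_sdiff {Sp T : Finset (E d)} (S : Finset (E d)) (hT : T ⊆ Sp) :
    Sp \ S = (Sp \ (S ∪ T)) ∪ (T \ S) := by
  ext α
  have := @hT α
  simp only [Finset.mem_sdiff, Finset.mem_union]
  tauto

theorem piP_sdiff {Sp T : Finset (E d)} (S : Finset (E d)) (hT : T ⊆ Sp) (x : E d) :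
    piP (Sp \ S) x = piP (Sp \ (S ∪ T)) x * piP (T \ S) x := by
  rw [sdiff_eq_union_sdiff S hT, piP, Finset.prod_union (disjoint_sdiff_union Sp S T)]
  rfl

theorem card_sdiff_eq_add {Sp T : Finset (E d)} (S : Finset (E d)) (hT : T ⊆ Sp) :
    (Sp \ S).card = (Sp \ (S ∪ T)).card + (T \ S).card := by
  rw [sdiff_eq_union_sdiff S hT, Finset.card_union_of_disjoint (disjoint_sdiff_union Sp S T)]

theorem tendsto_spherical [Fintype ↥(weylGroup Sig)] (hR : IsReducedSystem Sig)
    (hP : IsPositiveSystem Sig Sp) {Φ : E d × E d → ℝ} (hΦ : ContDiff ℝ ∞ Φ)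
    (hΦN : ∀ p, altSum Sig p = piP Sp p.1 * piP Sp p.2 * Φ p) {lam Y : E d}
    (hlam : ∀ α ∈ Sp, 0 ≤ ⟪α, lam⟫) (hY : ∀ α ∈ Sp, 0 ≤ ⟪α, Y⟫)
    (hKM : ∀ w : ↥(weylGroup Sig), ⟪lam, w.1 Y⟫ = ⟪lam, Y⟫ →
      ∃ w₁ w₂ : ↥(weylGroup Sig), w₁.1 lam = lam ∧ w₂.1 Y = Y ∧ w = w₁ * w₂)
    {S T : Finset (E d)} (hS : S = orthRoots Sp lam) (hT : T = orthRoots Sp Y) :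
    Filter.Tendsto (fun t : ℝ => t ^ (Sp \ (S ∪ T)).card * Real.exp (-(t * ⟪lam, Y⟫)) *
      Φ (lam, t • Y)) Filter.atTop
      (𝓝 ((Finset.univ.filter fun w : ↥(weylGroup Sig) => ⟪lam, w.1 Y⟫ = ⟪lam, Y⟫).card *
        (piP (T \ S) lam * (cConst (S ∩ T) * piP (S \ T) Y)) /
        (cConst T * (cConst S * (piP (Sp \ S) lam * piP (Sp \ T) Y))))) := by
  have hSp : S ⊆ Sp := hS ▸ orthRoots_subset Sp lam
  have hTp : T ⊆ Sp := hT ▸ orthRoots_subset Sp Y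
  have hSlam : ∀ α ∈ S, ⟪α, lam⟫ = 0 := fun α hα => (mem_orthRoots.1 (hS ▸ hα)).2
  have hTY : ∀ α ∈ T, ⟪α, Y⟫ = 0 := fun α hα => (mem_orthRoots.1 (hT ▸ hα)).2
  set A := piP (T \ S) lam * (cConst (S ∩ T) * piP (S \ T) Y) with hA
  have hterm : ∀ w : ↥(weylGroup Sig), Filter.Tendsto (fun t : ℝ =>
      dsign w.1 * Dop T.toList (fun y => piExp S lam (w.1 y)) (t • Y) / t ^ (S \ T).card *
        Real.exp (-(t * ⟪lam, Y⟫))) Filter.atTop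
      (𝓝 (if ⟪lam, w.1 Y⟫ = ⟪lam, Y⟫ then A else 0)) := by
    intro w
    split_ifs with hw
    · obtain ⟨w₁, w₂, hw₁, hw₂, rfl⟩ := hKM w hw
      refine (tendsto_Dop_piExp hSlam hTY).congr fun t => ?_
      rw [Subgroup.coe_mul, hS, hT, dsign_mul_Dop_piExp_mul hR hP hlam hY w₁.2 w₂.2 hw₁ hw₂]
    · have h := (tendsto_Dop_piExp_zero S (T.toList.map w.1)
        (lt_of_le_of_ne (inner_apply_le hR hP hlam hY w.2) hw) (S \ T).card).const_mul (dsign w.1)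
      rw [mul_zero] at h
      refine h.congr fun t => ?_
      rw [Dop_comp_isometry (contDiff_piExp S lam), map_smul]
      ring
  have hsum := tendsto_finsetSum Finset.univ fun w _ => hterm w
  rw [← Finset.sum_filter, Finset.sum_const, nsmul_eq_mul] at hsum
  have hne : cConst T * (cConst S * (piP (Sp \ S) lam * piP (Sp \ T) Y)) ≠ 0 := by
    rw [hS, hT]
    exact mul_ne_zero (cConst_orthRoots_ne_zero hR hP Y)
      (mul_ne_zero (cConst_orthRoots_ne_zero hR hP lam)
        (mul_ne_zero (piP_sdiff_orthRoots_ne_zero Sp lam) (piP_sdiff_orthRoots_ne_zero Sp Y)))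
  refine (hsum.div_const _).congr' ?_
  filter_upwards [Filter.eventually_gt_atTop 0] with t ht
  rw [← Finset.sum_mul, ← Finset.sum_div, sum_dsign_Dop_piExp hΦ hΦN hSp hTp hSlam
    fun α hα => by rw [inner_smul_right, hTY α hα, mul_zero], piP_smul,
    card_sdiff_eq_add T hSp, Finset.union_comm T S, div_eq_iff hne, pow_add]
  field_simp

end SphericalAsymptotics

/-- asymptotics of the spherical functions. There is a unique continuous
`Φ` on `ℝ^d × ℝ^d` with `Φ(λ,Y) = (π(λ)π(Y))⁻¹ ∑_{w∈W} det(w) e^{⟪λ,wY⟫}` whenever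
`π(λ)π(Y) ≠ 0`; and for singular `λ₀, Y₀` in the closed positive Weyl chamber satisfying the
Killing-max property,
`t^m e^{-t⟪λ₀,Y₀⟫} Φ(λ₀, tY₀) → (c_{λ₀,Y₀}/(c_{λ₀}c_{Y₀})) (|W_{λ₀}||W_{Y₀}|/|W_{λ₀}∩W_{Y₀}|)
(π_M(λ₀)π_M(Y₀))⁻¹` as `t → ∞`. -/
theorem stmt_9 (d : ℕ) (hd : 1 ≤ d) (Sig Sp : Finset (E d))
    (hroot : IsRootSystem Sig) (hpos : IsPositiveSystem Sig Sp)
    [Fintype ↥(weylGroup Sig)]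
    (lam0 Y0 : E d)
    (hlam0chamber : ∀ α ∈ Sp, 0 ≤ ⟪α, lam0⟫) (hY0chamber : ∀ α ∈ Sp, 0 ≤ ⟪α, Y0⟫)
    (hlam0sing : ∃ α ∈ Sig, ⟪α, lam0⟫ = 0) (hY0sing : ∃ α ∈ Sig, ⟪α, Y0⟫ = 0)
    (hKM : ∀ w : ↥(weylGroup Sig), ⟪lam0, w.1 Y0⟫ = ⟪lam0, Y0⟫ ↔
      ∃ w₁ w₂ : ↥(weylGroup Sig), w₁.1 lam0 = lam0 ∧ w₂.1 Y0 = Y0 ∧ w = w₁ * w₂)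
    (SL SY M : Finset (E d))
    (hSL : SL = Sp.filter (fun α => ⟪α, lam0⟫ = 0))
    (hSY : SY = Sp.filter (fun α => ⟪α, Y0⟫ = 0))
    (hM : M = Sp \ (SL ∪ SY))
    (WL WY WLY : Finset ↥(weylGroup Sig))
    (hWL : WL = Finset.univ.filter (fun w : ↥(weylGroup Sig) => w.1 lam0 = lam0))
    (hWY : WY = Finset.univ.filter (fun w : ↥(weylGroup Sig) => w.1 Y0 = Y0))
    (hWLY : WLY = Finset.univ.filter
      (fun w : ↥(weylGroup Sig) => w.1 lam0 = lam0 ∧ w.1 Y0 = Y0)) :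
    ∃ Φ : E d × E d → ℝ,
      Continuous Φ ∧
      (∀ lam Y : E d, piP Sp lam * piP Sp Y ≠ 0 →
        Φ (lam, Y) = (piP Sp lam * piP Sp Y)⁻¹ *
          ∑ w : ↥(weylGroup Sig), dsign w.1 * Real.exp ⟪lam, w.1 Y⟫) ∧
      (∀ Φ' : E d × E d → ℝ, Continuous Φ' →
        (∀ lam Y : E d, piP Sp lam * piP Sp Y ≠ 0 →
          Φ' (lam, Y) = (piP Sp lam * piP Sp Y)⁻¹ *
            ∑ w : ↥(weylGroup Sig), dsign w.1 * Real.exp ⟪lam, w.1 Y⟫) →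
        Φ' = Φ) ∧
      Filter.Tendsto
        (fun t : ℝ => t ^ M.card * Real.exp (-(t * ⟪lam0, Y0⟫)) * Φ (lam0, t • Y0))
        Filter.atTop
        (nhds ((cConst (SL ∩ SY) / (cConst SL * cConst SY)) *
          ((WL.card : ℝ) * (WY.card : ℝ) / (WLY.card : ℝ)) *
          (piP M lam0 * piP M Y0)⁻¹)) := by
  have hR := hroot.isReducedSystem
  obtain ⟨Φ, hΦ, hΦN⟩ := exists_contDiff_altSum_eq hR hpos
  have hreg : ∀ lam Y : E d, piP Sp lam * piP Sp Y ≠ 0 →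
      Φ (lam, Y) = (piP Sp lam * piP Sp Y)⁻¹ *
        ∑ w : ↥(weylGroup Sig), dsign w.1 * Real.exp ⟪lam, w.1 Y⟫ := by
    intro lam Y h
    rw [eq_inv_mul_iff_mul_eq₀ h]
    exact (hΦN (lam, Y)).symm
  refine ⟨Φ, hΦ.continuous, hreg, fun Φ' hΦ' h' => ?_, ?_⟩
  · exact eq_of_continuous_of_eq_on_regular hR hpos hΦ' hΦ.continuous fun p hp =>
      (h' p.1 p.2 hp).trans (hreg p.1 p.2 hp).symm
  have hlim := tendsto_spherical hR hpos hΦ hΦN hlam0chamber hY0chamber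
    (fun w => (hKM w).1) hSL hSY
  have hSp : SL ⊆ Sp := hSL ▸ Finset.filter_subset _ _
  have hYp : SY ⊆ Sp := hSY ▸ Finset.filter_subset _ _
  have hcard : ((Finset.univ.filter
      fun w : ↥(weylGroup Sig) => ⟪lam0, w.1 Y0⟫ = ⟪lam0, Y0⟫).card : ℝ) =
      (WL.card : ℝ) * WY.card / WLY.card := by
    have h := Subgroup.card_filter_mul (weylStabilizer Sig lam0) (weylStabilizer Sig Y0)
    have hWLY0 : (WLY.card : ℝ) ≠ 0 := by
      have h1 : (1 : ↥(weylGroup Sig)) ∈ WLY := by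
        rw [hWLY, Finset.mem_filter]
        exact ⟨Finset.mem_univ _, rfl, rfl⟩
      exact Nat.cast_ne_zero.2 (Finset.card_ne_zero_of_mem h1)
    rw [eq_div_iff hWLY0, hWL, hWY, hWLY]
    norm_cast
    convert h using 3 <;> ext w <;> simp only [Finset.mem_filter, Finset.mem_univ, true_and,
      mem_weylStabilizer, hKM w]
    exact ⟨fun ⟨a, b, ha, hb, h⟩ => ⟨a, ha, b, hb, h⟩, fun ⟨a, ha, b, hb, h⟩ => ⟨a, b, ha, hb, h⟩⟩
  have h1 : piP (Sp \ SL) lam0 ≠ 0 := hSL ▸ piP_sdiff_orthRoots_ne_zero Sp lam0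
  have h2 : piP (Sp \ SY) Y0 ≠ 0 := hSY ▸ piP_sdiff_orthRoots_ne_zero Sp Y0
  rw [piP_sdiff SL hYp, ← hM] at h1
  rw [piP_sdiff SY hSp, Finset.union_comm, ← hM] at h2
  rw [piP_sdiff SL hYp, piP_sdiff SY hSp, Finset.union_comm SY, ← hM, hcard] at hlim
  convert hlim using 2
  have h3 := left_ne_zero_of_mul h1
  have h4 := right_ne_zero_of_mul h1
  have h5 := left_ne_zero_of_mul h2
  have h6 := right_ne_zero_of_mul h2
  have h7 : cConst SL ≠ 0 := hSL ▸ cConst_orthRoots_ne_zero hR hpos lam0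
  have h8 : cConst SY ≠ 0 := hSY ▸ cConst_orthRoots_ne_zero hR hpos Y0
  field_simp
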